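/- arXiv:1612.00597 — 5 statements merged into one kernel-verified Lean document; each statement's English description precedes it below -/
import Mathlib

section
/- If f(z) = Σ_{n=0}^∞ a_n z^n is analytic in the open unit disk 𝔻 with ‖f‖_∞ = sup_{z∈𝔻} |f(z)| < ∞, then Σ_{n=0}^∞ |a_n| r^n ≤ ‖f‖_∞ for all 0 ≤ r ≤ 1/3. Moreover, the radius 1/3 is best possible: for every r with 1/3 < r < 1 there exists a function f analytic in 𝔻 with ‖f‖_∞ ≤ 1 whose Taylor coefficients a_n satisfy Σ_{n=0}^∞ |a_n| r^n > 1. -/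
open Complex in
/-- Orthogonality of the characters of the circle. -/
theorem integral_exp_int_mul_I (j : ℤ) :
    ∫ θ in (0 : ℝ)..2 * Real.pi, exp (j * θ * I) = if j = 0 then 2 * (Real.pi : ℂ) else 0 := by
  split_ifs with h
  · simp [h]
  · have hc : (j : ℂ) * I ≠ 0 := mul_ne_zero (by exact_mod_cast h) I_ne_zero
    have h1 := integral_exp_mul_complex (a := 0) (b := 2 * Real.pi) hc
    have h2 : exp ((j : ℂ) * I * ((2 * Real.pi : ℝ) : ℂ)) = 1 := by
      rw [exp_eq_one_iff]
      exact ⟨j, by push_cast; ring⟩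
    rw [h2] at h1
    simp only [ofReal_zero, mul_zero, exp_zero, sub_self, zero_div] at h1
    rw [← h1]
    congr 1 with θ
    ring_nf

open Complex MeasureTheory in
/-- The integral of a power series over a circle against `2 + u e^{-inθ} + ū e^{inθ}`. -/
theorem integral_powerSeries_mul_kernel {g : ℂ → ℂ} {a : ℕ → ℂ}
    (hg : ∀ z : ℂ, ‖z‖ < 1 → HasSum (fun n : ℕ => a n * z ^ n) (g z))
    {R : ℝ} (hR0 : 0 < R) (hR1 : R < 1) {n : ℕ} (hn : n ≠ 0) (u : ℂ) :
    ∫ θ in (0 : ℝ)..2 * Real.pi, g (R * exp (θ * I)) *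
        (2 + u * exp (-(n * θ * I)) + (starRingEnd ℂ) u * exp (n * θ * I)) =
      2 * Real.pi * (2 * a 0 + u * (a n * R ^ n)) := by
  set p : ℝ → ℂ := fun θ =>
    2 + u * exp (-(n * θ * I)) + (starRingEnd ℂ) u * exp (n * θ * I) with hp
  have hpc : Continuous p := by fun_prop
  have hsum : Summable fun k => ‖a k‖ * R ^ k := by
    have := (hg R (by simpa [abs_of_pos hR0] using hR1)).summable.norm
    simpa [abs_of_pos hR0] using this
  have hpb : ∀ θ, ‖p θ‖ ≤ 2 + ‖u‖ + ‖u‖ := fun θ => by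
    have h1 : ‖exp (-(n * θ * I))‖ = 1 := by
      simpa using norm_exp_ofReal_mul_I (-(n * θ))
    have h2 : ‖exp (n * θ * I)‖ = 1 := by
      simpa using norm_exp_ofReal_mul_I (n * θ)
    refine (norm_add₃_le).trans ?_
    simp [h1, h2]
  have key : HasSum
      (fun k => ∫ θ in (0 : ℝ)..2 * Real.pi, a k * (R * exp (θ * I)) ^ k * p θ)
      (∫ θ in (0 : ℝ)..2 * Real.pi, g (R * exp (θ * I)) * p θ) := by
    refine intervalIntegral.hasSum_integral_of_dominated_convergence
      (fun k _ => ‖a k‖ * R ^ k * (2 + ‖u‖ + ‖u‖)) (fun k => ?_) (fun k => ?_) ?_ ?_ ?_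
    · exact Continuous.aestronglyMeasurable (by fun_prop)
    · refine Filter.Eventually.of_forall fun θ _ => ?_
      rw [norm_mul, norm_mul, norm_pow, norm_mul, norm_exp_ofReal_mul_I, norm_real,
        Real.norm_of_nonneg hR0.le, mul_one]
      exact mul_le_mul_of_nonneg_left (hpb θ) (by positivity)
    · exact Filter.Eventually.of_forall fun θ _ => hsum.mul_right _
    · exact intervalIntegrable_const
    · refine Filter.Eventually.of_forall fun θ _ => (hg _ ?_).mul_right _
      rwa [norm_mul, norm_exp_ofReal_mul_I, norm_real, Real.norm_of_nonneg hR0.le, mul_one]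
  have hterm : ∀ k : ℕ, ∫ θ in (0 : ℝ)..2 * Real.pi, a k * (R * exp (θ * I)) ^ k * p θ =
      a k * R ^ k * (2 * (if (k : ℤ) = 0 then 2 * (Real.pi : ℂ) else 0)
        + u * (if (k - n : ℤ) = 0 then 2 * (Real.pi : ℂ) else 0)
        + (starRingEnd ℂ) u * (if (k + n : ℤ) = 0 then 2 * (Real.pi : ℂ) else 0)) := by
    intro k
    simp only [← integral_exp_int_mul_I, ← intervalIntegral.integral_const_mul]
    rw [← intervalIntegral.integral_add, ← intervalIntegral.integral_add,
      ← intervalIntegral.integral_const_mul]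
    · congr 1 with θ
      have e1 : exp (((k - n : ℤ) : ℂ) * θ * I) = exp (k * θ * I) * exp (-(n * θ * I)) := by
        rw [← exp_add]; push_cast; ring_nf
      have e2 : exp (((k + n : ℤ) : ℂ) * θ * I) = exp (k * θ * I) * exp (n * θ * I) := by
        rw [← exp_add]; push_cast; ring_nf
      have e3 : exp (θ * I) ^ k = exp (k * θ * I) := by
        rw [← exp_nat_mul]; ring_nf
      rw [e1, e2, mul_pow, e3, hp]
      push_cast
      ring
    all_goals exact Continuous.intervalIntegrable (by fun_prop) _ _
  simp only [hterm] at key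
  have hfin := hasSum_sum_of_ne_finset_zero (L := .unconditional ℕ) (s := {0, n}) (f := fun k : ℕ =>
      a k * R ^ k * (2 * (if (k : ℤ) = 0 then 2 * (Real.pi : ℂ) else 0)
        + u * (if (k - n : ℤ) = 0 then 2 * (Real.pi : ℂ) else 0)
        + (starRingEnd ℂ) u * (if (k + n : ℤ) = 0 then 2 * (Real.pi : ℂ) else 0)))
      (fun k hk => by
        simp only [Finset.mem_insert, Finset.mem_singleton, not_or] at hk
        rw [if_neg (by omega), if_neg (by omega), if_neg (by omega)]
        simp)
  rw [key.unique hfin, Finset.sum_pair hn.symm]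
  have hn' : (n : ℤ) + n ≠ 0 := by omega
  simp [hn, hn']
  ring

open Complex MeasureTheory in
/-- **Carathéodory's coefficient inequality**: the coefficients of a power series with nonnegative
real part on the unit disk satisfy `|aₙ| ≤ 2 Re a₀` for `n ≥ 1`. -/
theorem norm_coeff_le_two_mul_re_of_re_nonneg {g : ℂ → ℂ} {a : ℕ → ℂ}
    (hg : ∀ z : ℂ, ‖z‖ < 1 → HasSum (fun n : ℕ => a n * z ^ n) (g z))
    (hre : ∀ z : ℂ, ‖z‖ < 1 → 0 ≤ (g z).re) {n : ℕ} (hn : n ≠ 0) :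
    ‖a n‖ ≤ 2 * (a 0).re := by
  obtain ⟨u, hu, hua⟩ : ∃ u : ℂ, ‖u‖ = 1 ∧ u * a n = -(‖a n‖ : ℂ) := by
    by_cases h : a n = 0
    · exact ⟨1, by simp, by simp [h]⟩
    · have h' : (‖a n‖ : ℂ) ≠ 0 := by simpa using h
      refine ⟨-(‖a n‖ : ℂ) / a n, by simp [h], div_mul_cancel₀ _ h⟩
  have hR : ∀ R : ℝ, 0 < R → R < 1 → ‖a n‖ * R ^ n ≤ 2 * (a 0).re := by
    intro R hR0 hR1
    have hI := integral_powerSeries_mul_kernel hg hR0 hR1 hn u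
    have hker : ∀ θ : ℝ, 2 + u * exp (-(n * θ * I)) + (starRingEnd ℂ) u * exp (n * θ * I) =
        ((2 + 2 * (u * exp (-(n * θ * I))).re : ℝ) : ℂ) := fun θ => by
      have hconj : (starRingEnd ℂ) u * exp (n * θ * I) =
          (starRingEnd ℂ) (u * exp (-(n * θ * I))) := by
        rw [map_mul, ← exp_conj]
        simp
      rw [hconj, add_assoc, add_conj]
      push_cast
      ring
    have hker_nonneg : ∀ θ : ℝ, 0 ≤ 2 + 2 * (u * exp (-(n * θ * I))).re := fun θ => by
      have h1 : ‖u * exp (-(n * θ * I))‖ = 1 := by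
        rw [norm_mul, hu, one_mul]
        simpa using norm_exp_ofReal_mul_I (-(n * θ))
      have := (abs_le.1 (abs_re_le_norm (u * exp (-(n * θ * I))))).1
      linarith
    have hnonneg : 0 ≤ (∫ θ in (0 : ℝ)..2 * Real.pi, g (R * exp (θ * I)) *
        (2 + u * exp (-(n * θ * I)) + (starRingEnd ℂ) u * exp (n * θ * I))).re := by
      by_cases hint : IntervalIntegrable (fun θ : ℝ => g (R * exp (θ * I)) *
        (2 + u * exp (-(n * θ * I)) + (starRingEnd ℂ) u * exp (n * θ * I))) volume 0 (2 * Real.pi)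
      · have := intervalIntegral.intervalIntegral_re hint
        rw [show ∀ z : ℂ, z.re = RCLike.re z from fun _ => rfl, ← this]
        refine intervalIntegral.integral_nonneg Real.two_pi_pos.le fun θ _ => ?_
        rw [hker]
        change 0 ≤ (_ * ((_ : ℝ) : ℂ)).re
        rw [re_mul_ofReal]
        refine mul_nonneg (hre _ ?_) (hker_nonneg θ)
        rwa [norm_mul, norm_exp_ofReal_mul_I, norm_real, Real.norm_of_nonneg hR0.le, mul_one]
      · rw [intervalIntegral.integral_undef hint, zero_re]
    have hval : 2 * (Real.pi : ℂ) * (2 * a 0 + u * (a n * R ^ n)) =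
        ((2 * Real.pi : ℝ) : ℂ) * (2 * a 0 - ((‖a n‖ * R ^ n : ℝ) : ℂ)) := by
      rw [← mul_assoc u, hua]
      push_cast
      ring
    rw [hI, hval, re_ofReal_mul, sub_re, ofReal_re] at hnonneg
    have := nonneg_of_mul_nonneg_right hnonneg Real.two_pi_pos
    simp at this
    linarith
  have ht : Filter.Tendsto (fun R : ℝ => ‖a n‖ * R ^ n) (nhdsWithin 1 (Set.Iio 1))
      (nhds (‖a n‖ * 1 ^ n)) :=
    ((by fun_prop : Continuous fun R : ℝ => ‖a n‖ * R ^ n).tendsto 1).mono_left nhdsWithin_le_nhds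
  rw [one_pow, mul_one] at ht
  refine le_of_tendsto ht ?_
  filter_upwards [Ioo_mem_nhdsLT (zero_lt_one' ℝ)] with R h using hR R h.1 h.2

/-- The coefficients of a power series bounded by `C` on the unit disk satisfy
`|aₙ| ≤ 2 (C - |a₀|)` for `n ≥ 1`. -/
theorem norm_coeff_le_two_mul_sub_norm {f : ℂ → ℂ} {a : ℕ → ℂ} {C : ℝ}
    (hf : ∀ z : ℂ, ‖z‖ < 1 → HasSum (fun n : ℕ => a n * z ^ n) (f z))
    (hC : ∀ z : ℂ, ‖z‖ < 1 → ‖f z‖ ≤ C) {n : ℕ} (hn : n ≠ 0) :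
    ‖a n‖ ≤ 2 * (C - ‖a 0‖) := by
  obtain ⟨u, hu, hua⟩ : ∃ u : ℂ, ‖u‖ = 1 ∧ u * a 0 = (‖a 0‖ : ℂ) := by
    by_cases h : a 0 = 0
    · exact ⟨1, by simp, by simp [h]⟩
    · exact ⟨(‖a 0‖ : ℂ) / a 0, by simp [h], div_mul_cancel₀ _ h⟩
  have key := norm_coeff_le_two_mul_re_of_re_nonneg (g := fun z => C - u * f z)
    (a := fun k => (if k = 0 then (C : ℂ) else 0) - u * a k)
    (fun z hz => by
      have h1 : HasSum (fun k : ℕ => (if k = 0 then (C : ℂ) else 0) * z ^ k) C := by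
        convert hasSum_ite_eq (0 : ℕ) (C : ℂ) using 2 with k
        split_ifs with h <;> simp [h]
      refine (h1.sub ((hf z hz).mul_left u)).congr_fun fun k => ?_
      ring)
    (fun z hz => by
      have h1 : (u * f z).re ≤ ‖f z‖ := by
        simpa [hu] using Complex.re_le_norm (u * f z)
      have := hC z hz
      simp only [Complex.sub_re, Complex.ofReal_re]
      linarith) hn
  simpa [hn, hu, hua] using key

/-- **Bohr's inequality**. -/
theorem tsum_norm_coeff_mul_pow_le {f : ℂ → ℂ} {a : ℕ → ℂ} {C : ℝ}
    (hf : ∀ z : ℂ, ‖z‖ < 1 → HasSum (fun n : ℕ => a n * z ^ n) (f z))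
    (hC : ∀ z : ℂ, ‖z‖ < 1 → ‖f z‖ ≤ C) {r : ℝ} (hr0 : 0 ≤ r) (hr : r ≤ 1 / 3) :
    ∑' n : ℕ, ‖a n‖ * r ^ n ≤ C := by
  set D : ℝ := 2 * (C - ‖a 0‖) with hD
  have hcoeff : ∀ n : ℕ, ‖a (n + 1)‖ ≤ D := fun n =>
    norm_coeff_le_two_mul_sub_norm hf hC n.succ_ne_zero
  have hD0 : 0 ≤ D := (norm_nonneg _).trans (hcoeff 0)
  have hbound : ∀ n : ℕ, ‖a (n + 1)‖ * r ^ (n + 1) ≤ D * (1 / 3) ^ (n + 1) := fun n => by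
    have := pow_le_pow_left₀ hr0 hr (n + 1)
    have := hcoeff n
    gcongr
  have hgeom : HasSum (fun n : ℕ => D * (1 / 3) ^ (n + 1)) (D / 2) := by
    have h := (hasSum_geometric_of_lt_one (r := (1 / 3 : ℝ)) (by norm_num)
      (by norm_num)).mul_left (D * (1 / 3))
    have hval : D * (1 / 3) * (1 - 1 / 3)⁻¹ = D / 2 := by ring
    rw [hval] at h
    refine h.congr_fun fun n => ?_
    ring
  have hs : Summable fun n : ℕ => ‖a (n + 1)‖ * r ^ (n + 1) :=
    hgeom.summable.of_nonneg_of_le (fun n => by positivity) hbound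
  have hle := hasSum_le hbound hs.hasSum hgeom
  rw [((summable_nat_add_iff (f := fun n => ‖a n‖ * r ^ n) 1).1 hs).tsum_eq_zero_add,
    pow_zero, mul_one]
  linarith

/-- The Taylor coefficients of the disk automorphism `z ↦ (t - z) / (1 - t z)`. -/
noncomputable def moebiusCoeff (t : ℝ) : ℕ → ℝ
  | 0 => t
  | n + 1 => -((1 - t ^ 2) * t ^ n)

theorem hasSum_moebiusCoeff {t : ℝ} (ht0 : 0 < t) (ht1 : t < 1) {z : ℂ} (hz : ‖z‖ < 1) :
    HasSum (fun n : ℕ => (moebiusCoeff t n : ℂ) * z ^ n) ((t - z) / (1 - t * z)) := by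
  have hlt : ‖(t : ℂ) * z‖ < 1 := by
    rw [norm_mul, Complex.norm_real, Real.norm_of_nonneg ht0.le]
    nlinarith [norm_nonneg z]
  have hne : (1 : ℂ) - t * z ≠ 0 := fun h => by
    rw [← sub_eq_zero.1 h, norm_one] at hlt
    exact lt_irrefl _ hlt
  rw [← hasSum_nat_add_iff' 1]
  have hval : (t - z) / (1 - t * z) - ∑ i ∈ Finset.range 1, (moebiusCoeff t i : ℂ) * z ^ i =
      -((1 - (t : ℂ) ^ 2) * z) * (1 - t * z)⁻¹ := by
    simp only [Finset.sum_range_one, moebiusCoeff, pow_zero, mul_one]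
    field_simp
    ring
  rw [hval]
  refine ((hasSum_geometric_of_norm_lt_one hlt).mul_left
    (-((1 - (t : ℂ) ^ 2) * z))).congr_fun fun n => ?_
  simp only [moebiusCoeff]
  push_cast
  ring

theorem norm_moebius_le_one {t : ℝ} (ht0 : 0 < t) (ht1 : t < 1) {z : ℂ} (hz : ‖z‖ < 1) :
    ‖(t - z) / (1 - t * z)‖ ≤ 1 := by
  rw [norm_div]
  refine div_le_one_of_le₀ ?_ (norm_nonneg _)
  rw [← sq_le_sq₀ (norm_nonneg _) (norm_nonneg _), Complex.sq_norm, Complex.sq_norm]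
  have h : z.re * z.re + z.im * z.im < 1 := by
    rw [← Complex.normSq_apply, ← Complex.sq_norm]
    nlinarith [norm_nonneg z]
  simp only [Complex.normSq_apply, Complex.sub_re, Complex.sub_im, Complex.mul_re, Complex.mul_im,
    Complex.ofReal_re, Complex.ofReal_im, Complex.one_re, Complex.one_im]
  have ht : t ^ 2 < 1 := by nlinarith
  nlinarith [mul_pos (sub_pos.2 ht) (sub_pos.2 h)]

theorem tsum_norm_moebiusCoeff_mul_pow {t r : ℝ} (ht0 : 0 < t) (ht1 : t < 1) (hr0 : 0 ≤ r)
    (hr1 : r < 1) :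
    ∑' n : ℕ, ‖(moebiusCoeff t n : ℂ)‖ * r ^ n = t + (1 - t ^ 2) * r / (1 - t * r) := by
  have ht : 0 < 1 - t ^ 2 := by nlinarith
  have hgeom := (hasSum_geometric_of_lt_one (r := t * r) (by positivity)
    (by nlinarith)).mul_left ((1 - t ^ 2) * r)
  refine HasSum.tsum_eq ?_
  rw [← hasSum_nat_add_iff' 1]
  have hval : t + (1 - t ^ 2) * r / (1 - t * r) -
      ∑ i ∈ Finset.range 1, ‖(moebiusCoeff t i : ℂ)‖ * r ^ i =
      (1 - t ^ 2) * r * (1 - t * r)⁻¹ := by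
    simp only [Finset.sum_range_one, moebiusCoeff, Complex.norm_real, Real.norm_of_nonneg ht0.le]
    ring
  rw [hval]
  refine hgeom.congr_fun fun n => ?_
  simp only [moebiusCoeff]
  rw [Complex.norm_real, norm_neg, Real.norm_of_nonneg (by positivity)]
  ring

/-- **Bohr's inequality** with sharpness of the radius 1/3.
If `f z = ∑ aₙ zⁿ` is analytic in the unit disk with finite sup-norm (i.e. bounded above
by some `C`), then `∑ |aₙ| rⁿ ≤ C` for `0 ≤ r ≤ 1/3`; moreover for each `1/3 < r < 1`
there is an analytic self-map of the disk whose majorant series at `r` exceeds `1`. -/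
theorem bohr_inequality_and_sharpness :
    (∀ (f : ℂ → ℂ) (a : ℕ → ℂ) (C : ℝ),
      (∀ z : ℂ, ‖z‖ < 1 → HasSum (fun n : ℕ => a n * z ^ n) (f z)) →
      (∀ z : ℂ, ‖z‖ < 1 → ‖f z‖ ≤ C) →
      ∀ r : ℝ, 0 ≤ r → r ≤ 1 / 3 → ∑' n : ℕ, ‖a n‖ * r ^ n ≤ C) ∧
    (∀ r : ℝ, 1 / 3 < r → r < 1 →
      ∃ (f : ℂ → ℂ) (a : ℕ → ℂ),
        (∀ z : ℂ, ‖z‖ < 1 → HasSum (fun n : ℕ => a n * z ^ n) (f z)) ∧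
        (∀ z : ℂ, ‖z‖ < 1 → ‖f z‖ ≤ 1) ∧
        1 < ∑' n : ℕ, ‖a n‖ * r ^ n) := by
  refine ⟨fun f a C hf hC r hr0 hr => tsum_norm_coeff_mul_pow_le hf hC hr0 hr, fun r hr hr1 => ?_⟩
  have hr0 : 0 < r := by linarith
  obtain ⟨t, ht, ht1⟩ : ∃ t, (1 - r) / (2 * r) < t ∧ t < 1 :=
    exists_between (by rw [div_lt_one (by positivity)]; linarith)
  have ht0 : 0 < t := lt_trans (div_pos (by linarith) (by positivity)) ht
  refine ⟨fun z => (t - z) / (1 - t * z), fun n => moebiusCoeff t n,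
    fun z hz => hasSum_moebiusCoeff ht0 ht1 hz, fun z hz => norm_moebius_le_one ht0 ht1 hz, ?_⟩
  rw [tsum_norm_moebiusCoeff_mul_pow ht0 ht1 hr0.le hr1]
  have hden : 0 < 1 - t * r := by nlinarith
  rw [div_lt_iff₀ (by positivity)] at ht
  have : 1 - t < (1 - t ^ 2) * r / (1 - t * r) := by
    rw [lt_div_iff₀ hden]
    nlinarith [mul_pos (sub_pos.2 ht1) (sub_pos.2 ht)]
  linarith
end

section
/- Let f be analytic and univalent (injective) in the open unit disk 𝔻, and let g(z) = Σ_{n=0}^∞ b_n z^n be analytic in 𝔻 and subordinate to f. Then Σ_{n=1}^∞ |b_n| r^n ≤ dist(f(0), ∂f(𝔻)) for all 0 ≤ r ≤ 3 − 2√2, where dist(f(0), ∂f(𝔻)) is the Euclidean distance from f(0) to the boundary of the image domain f(𝔻). -/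
namespace BohrUnivalent

open Metric Filter Topology
open scoped Real

/-- The Taylor coefficients at the origin. -/
noncomputable def taylorCoeff (f : ℂ → ℂ) (n : ℕ) : ℂ := iteratedDeriv n f 0 / n.factorial

/-- The majorant series of `f`, evaluated at `r`. -/
noncomputable def majorant (f : ℂ → ℂ) (r : ℝ) : ℝ := ∑' n, ‖taylorCoeff f n‖ * r ^ n

theorem hasSum_taylorCoeff {f : ℂ → ℂ} (hf : DifferentiableOn ℂ f (ball 0 1)) {z : ℂ}
    (hz : ‖z‖ < 1) : HasSum (fun n => taylorCoeff f n * z ^ n) (f z) := by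
  have := Complex.hasSum_taylorSeries_on_ball hf (z := z) (by simpa using hz)
  convert! this using 2 with n
  simp [taylorCoeff]; ring

theorem taylorCoeff_eq_of_hasSum {f : ℂ → ℂ} {a : ℕ → ℂ} {δ : ℝ} (hδ : 0 < δ)
    (h : ∀ z : ℂ, ‖z‖ < δ → HasSum (fun n => a n * z ^ n) (f z)) : taylorCoeff f = a := by
  have h1 : HasFPowerSeriesAt f (FormalMultilinearSeries.ofScalars ℂ a) 0 := by
    rw [hasFPowerSeriesAt_iff']
    filter_upwards [ball_mem_nhds (0 : ℂ) hδ] with z hz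
    simpa [FormalMultilinearSeries.coeff_ofScalars, mul_comm] using h z (by simpa using hz)
  have h2 := h1.analyticAt.hasFPowerSeriesAt
  have h3 := h2.eq_formalMultilinearSeries h1
  rwa [FormalMultilinearSeries.ofScalars_series_eq_iff] at h3

theorem taylorCoeff_zero (f : ℂ → ℂ) : taylorCoeff f 0 = f 0 := by simp [taylorCoeff]

theorem taylorCoeff_one (f : ℂ → ℂ) : taylorCoeff f 1 = deriv f 0 := by simp [taylorCoeff]

theorem summable_majorant {f : ℂ → ℂ} (hf : DifferentiableOn ℂ f (ball 0 1)) {r : ℝ}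
    (h0 : 0 ≤ r) (h1 : r < 1) : Summable fun n => ‖taylorCoeff f n‖ * r ^ n := by
  have := (hasSum_taylorCoeff hf (z := r) (by simpa [abs_of_nonneg h0] using h1)).summable.norm
  simpa [abs_of_nonneg h0] using this

theorem majorant_nonneg (f : ℂ → ℂ) {r : ℝ} (h0 : 0 ≤ r) : 0 ≤ majorant f r :=
  tsum_nonneg fun _ => by positivity

theorem taylorCoeff_mul {f g : ℂ → ℂ} (hf : DifferentiableOn ℂ f (ball 0 1))
    (hg : DifferentiableOn ℂ g (ball 0 1)) :
    taylorCoeff (fun z => f z * g z) = fun n =>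
      ∑ p ∈ Finset.HasAntidiagonal.antidiagonal n, taylorCoeff f p.1 * taylorCoeff g p.2 := by
  refine taylorCoeff_eq_of_hasSum one_pos fun z hz => ?_
  have hF := hasSum_taylorCoeff hf hz
  have hG := hasSum_taylorCoeff hg hz
  have h1 := (summable_norm_sum_mul_antidiagonal_of_summable_norm hF.summable.norm
    hG.summable.norm).of_norm.hasSum
  rw [← tsum_mul_tsum_eq_tsum_sum_antidiagonal_of_summable_norm hF.summable.norm
    hG.summable.norm, hF.tsum_eq, hG.tsum_eq] at h1
  convert! h1 using 2 with n
  rw [Finset.sum_mul]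
  refine Finset.sum_congr rfl fun p hp => ?_
  rw [← Finset.HasAntidiagonal.mem_antidiagonal.1 hp, pow_add]; ring

theorem taylorCoeff_add {f g : ℂ → ℂ} (hf : DifferentiableOn ℂ f (ball 0 1))
    (hg : DifferentiableOn ℂ g (ball 0 1)) :
    taylorCoeff (fun z => f z + g z) = fun n => taylorCoeff f n + taylorCoeff g n := by
  refine taylorCoeff_eq_of_hasSum one_pos fun z hz => ?_
  simpa [add_mul] using (hasSum_taylorCoeff hf hz).add (hasSum_taylorCoeff hg hz)

theorem majorant_add_le {f g : ℂ → ℂ} (hf : DifferentiableOn ℂ f (ball 0 1))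
    (hg : DifferentiableOn ℂ g (ball 0 1)) {r : ℝ} (h0 : 0 ≤ r) (h1 : r < 1) :
    majorant (fun z => f z + g z) r ≤ majorant f r + majorant g r := by
  have hF := summable_majorant hf h0 h1
  have hG := summable_majorant hg h0 h1
  unfold majorant
  rw [← hF.tsum_add hG]
  refine Summable.tsum_le_tsum (fun n => ?_) (summable_majorant (hf.fun_add hg) h0 h1) (hF.add hG)
  rw [taylorCoeff_add hf hg, ← add_mul]
  gcongr
  exact norm_add_le _ _

theorem majorant_mul_le {f g : ℂ → ℂ} (hf : DifferentiableOn ℂ f (ball 0 1))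
    (hg : DifferentiableOn ℂ g (ball 0 1)) {r : ℝ} (h0 : 0 ≤ r) (h1 : r < 1) :
    majorant (fun z => f z * g z) r ≤ majorant f r * majorant g r := by
  have hF := summable_majorant hf h0 h1
  have hG := summable_majorant hg h0 h1
  have hF' : Summable fun n => ‖‖taylorCoeff f n‖ * r ^ n‖ := hF.norm
  have hG' : Summable fun n => ‖‖taylorCoeff g n‖ * r ^ n‖ := hG.norm
  unfold majorant
  rw [tsum_mul_tsum_eq_tsum_sum_antidiagonal_of_summable_norm hF' hG']
  refine Summable.tsum_le_tsum (fun n => ?_) (summable_majorant (hf.fun_mul hg) h0 h1)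
    (summable_norm_sum_mul_antidiagonal_of_summable_norm hF' hG').of_norm
  rw [taylorCoeff_mul hf hg]
  calc _ ≤ (∑ p ∈ Finset.HasAntidiagonal.antidiagonal n, ‖taylorCoeff f p.1 * taylorCoeff g p.2‖) * r ^ n := by
        gcongr; exact norm_sum_le _ _
    _ = _ := by
      rw [Finset.sum_mul]
      refine Finset.sum_congr rfl fun p hp => ?_
      rw [← Finset.HasAntidiagonal.mem_antidiagonal.1 hp, pow_add, norm_mul]; ring

theorem taylorCoeff_const (c : ℂ) : taylorCoeff (fun _ => c) = fun n => if n = 0 then c else 0 := by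
  refine taylorCoeff_eq_of_hasSum one_pos fun z _ => ?_
  convert! hasSum_ite_eq 0 c using 2 with n
  split_ifs with h <;> simp [h]

theorem majorant_const (c : ℂ) (r : ℝ) : majorant (fun _ => c) r = ‖c‖ := by
  unfold majorant
  rw [tsum_eq_single 0 (by intro n hn; simp [taylorCoeff_const, hn])]
  simp [taylorCoeff_const]

theorem majorant_pow_le {f : ℂ → ℂ} (hf : DifferentiableOn ℂ f (ball 0 1)) {r : ℝ}
    (h0 : 0 ≤ r) (h1 : r < 1) (k : ℕ) :
    majorant (fun z => f z ^ k) r ≤ majorant f r ^ k := by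
  induction k with
  | zero => simp [majorant_const]
  | succ k ih =>
    simp only [pow_succ]
    refine (majorant_mul_le (hf.fun_pow k) hf h0 h1).trans ?_
    gcongr
    exact majorant_nonneg _ h0

theorem majorant_comp_le {f w : ℂ → ℂ} (hf : DifferentiableOn ℂ f (ball 0 1))
    (hw : DifferentiableOn ℂ w (ball 0 1)) (hw1 : ∀ z, ‖z‖ < 1 → ‖w z‖ < 1) {r s : ℝ}
    (h0 : 0 < r) (h1 : r < 1) (hs : s < 1) (hrs : majorant w r ≤ s) :
    majorant (fun z => f (w z)) r ≤ majorant f s := by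
  have hM0 := majorant_nonneg w h0.le
  have hs0 := hM0.trans hrs
  have hfs := summable_majorant hf hs0 hs
  set c : ℕ → ℕ → ℂ := fun k n => taylorCoeff f k * taylorCoeff (fun z => w z ^ k) n
  have hcn : ∀ k, Summable fun n => ‖c k n‖ * r ^ n := fun k => by
    simpa [c, norm_mul, mul_assoc] using
      (summable_majorant (hw.fun_pow k) h0.le h1).mul_left ‖taylorCoeff f k‖
  have hck : ∀ k, ∑' n, ‖c k n‖ * r ^ n ≤ ‖taylorCoeff f k‖ * s ^ k := fun k => by
    simp only [c, norm_mul, mul_assoc, tsum_mul_left]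
    gcongr
    exact (majorant_pow_le hw h0.le h1 k).trans (by gcongr)
  have hsum : Summable fun p : ℕ × ℕ => ‖c p.1 p.2‖ * r ^ p.2 := by
    refine (summable_prod_of_nonneg fun p => by positivity).2 ⟨hcn, ?_⟩
    exact Summable.of_nonneg_of_le (fun k => tsum_nonneg fun n => by positivity) hck hfs
  have hcoef : taylorCoeff (fun z => f (w z)) = fun n => ∑' k, c k n := by
    refine taylorCoeff_eq_of_hasSum h0 fun z hz => ?_
    have hz1 : ‖z‖ < 1 := hz.trans h1
    have hS : Summable fun p : ℕ × ℕ => c p.1 p.2 * z ^ p.2 := by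
      refine Summable.of_norm_bounded hsum fun p => ?_
      rw [norm_mul, norm_pow]; gcongr
    have h2 : HasSum (fun p : ℕ × ℕ => c p.1 p.2 * z ^ p.2) (f (w z)) := by
      have := hS.hasSum
      have h3 : HasSum (fun k => taylorCoeff f k * w z ^ k) (∑' p : ℕ × ℕ, c p.1 p.2 * z ^ p.2) :=
        this.prod_fiberwise fun k => by
          simpa [c, mul_assoc] using
            (hasSum_taylorCoeff (hw.fun_pow k) hz1).mul_left (taylorCoeff f k)
      rwa [h3.unique (hasSum_taylorCoeff hf (hw1 z hz1))] at this
    have h4 : HasSum (fun q : ℕ × ℕ => c q.2 q.1 * z ^ q.1) (f (w z)) :=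
      (Equiv.prodComm ℕ ℕ).hasSum_iff (f := fun p : ℕ × ℕ => c p.1 p.2 * z ^ p.2) |>.2 h2
    have h5 : Summable fun q : ℕ × ℕ => c q.2 q.1 * z ^ q.1 := h4.summable
    have h6 := h4.prod_fiberwise fun n => (h5.prod_factor n).hasSum
    simpa [tsum_mul_right] using h6
  have hsum' : Summable fun q : ℕ × ℕ => ‖c q.2 q.1‖ * r ^ q.1 :=
    (Equiv.prodComm ℕ ℕ).summable_iff (f := fun p : ℕ × ℕ => ‖c p.1 p.2‖ * r ^ p.2) |>.2 hsum
  calc majorant (fun z => f (w z)) r = ∑' n, ‖∑' k, c k n‖ * r ^ n := by rw [majorant, hcoef]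
    _ ≤ ∑' n, ∑' k, ‖c k n‖ * r ^ n := by
      have hle : ∀ n, ‖∑' k, c k n‖ * r ^ n ≤ ∑' k, ‖c k n‖ * r ^ n := fun n => by
        rw [tsum_mul_right]
        gcongr
        refine norm_tsum_le_tsum_norm ?_
        have := (hsum'.prod_factor n).mul_right (r ^ n)⁻¹
        refine this.congr fun k => ?_
        field_simp
      exact Summable.tsum_le_tsum hle
        (Summable.of_nonneg_of_le (fun n => by positivity) hle hsum'.prod) hsum'.prod
    _ = ∑' k, ∑' n, ‖c k n‖ * r ^ n :=
      Summable.tsum_comm (f := fun k n => ‖c k n‖ * r ^ n) hsum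
    _ ≤ ∑' k, ‖taylorCoeff f k‖ * s ^ k := Summable.tsum_le_tsum hck
        (Summable.of_nonneg_of_le (fun k => tsum_nonneg fun n => by positivity) hck hfs) hfs

theorem norm_mul_exp_lt_one {s : ℝ} (h0 : 0 ≤ s) (h1 : s < 1) (θ : ℝ) :
    ‖(s : ℂ) * Complex.exp (θ * Complex.I)‖ < 1 := by
  rwa [norm_mul, Complex.norm_exp_ofReal_mul_I, mul_one, Complex.norm_real,
    Real.norm_of_nonneg h0]

theorem continuous_circle {f : ℂ → ℂ} (hf : DifferentiableOn ℂ f (ball 0 1)) {s : ℝ}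
    (h0 : 0 ≤ s) (h1 : s < 1) : Continuous fun θ : ℝ => f (s * Complex.exp (θ * Complex.I)) :=
  hf.continuousOn.comp_continuous (by fun_prop)
    fun θ => by simpa using norm_mul_exp_lt_one h0 h1 θ

theorem integral_exp_int (k : ℤ) :
    ∫ θ in (0 : ℝ)..2 * π, Complex.exp (k * (θ * Complex.I)) = if k = 0 then 2 * π else 0 := by
  split_ifs with h
  · simp [h]
  · have hk : (k : ℂ) * Complex.I ≠ 0 := by simp [h]
    have := integral_exp_mul_complex (a := 0) (b := 2 * π) hk
    have h2 : ∀ θ : ℝ, (k : ℂ) * (θ * Complex.I) = k * Complex.I * θ := fun θ => by ring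
    simp only [h2, this]
    have h3 : (k : ℂ) * Complex.I * ((2 * π : ℝ) : ℂ) = k * (2 * π * Complex.I) := by
      push_cast; ring
    rw [h3, Complex.exp_int_mul_two_pi_mul_I]
    simp

theorem integral_circle_mul_exp {f : ℂ → ℂ} (hf : DifferentiableOn ℂ f (ball 0 1)) {s : ℝ}
    (h0 : 0 ≤ s) (h1 : s < 1) (k : ℤ) :
    ∫ θ in (0 : ℝ)..2 * π, f (s * Complex.exp (θ * Complex.I)) *
      Complex.exp (-k * (θ * Complex.I)) =
      2 * π * if 0 ≤ k then taylorCoeff f k.toNat * s ^ k.toNat else 0 := by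
  have hterm : ∀ (n : ℕ) (θ : ℝ), taylorCoeff f n * (s * Complex.exp (θ * Complex.I)) ^ n *
      Complex.exp (-k * (θ * Complex.I)) =
      taylorCoeff f n * s ^ n * Complex.exp (((n - k : ℤ) : ℂ) * (θ * Complex.I)) := by
    intro n θ
    rw [mul_pow, ← Complex.exp_nat_mul]
    push_cast
    rw [show ((n : ℂ) - k) * (θ * Complex.I) = n * (θ * Complex.I) + -k * (θ * Complex.I) by ring,
      Complex.exp_add]
    ring
  have hexp : ∀ (n : ℤ) (θ : ℝ), ‖Complex.exp ((n : ℂ) * (θ * Complex.I))‖ = 1 := by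
    intro n θ
    rw [show (n : ℂ) * (θ * Complex.I) = ((n * θ : ℝ) : ℂ) * Complex.I by push_cast; ring,
      Complex.norm_exp_ofReal_mul_I]
  have hs := summable_majorant hf h0 h1
  have key : HasSum (fun n : ℕ => ∫ θ in (0 : ℝ)..2 * π,
      taylorCoeff f n * s ^ n * Complex.exp (((n - k : ℤ) : ℂ) * (θ * Complex.I)))
      (∫ θ in (0 : ℝ)..2 * π, f (s * Complex.exp (θ * Complex.I)) *
      Complex.exp (-k * (θ * Complex.I))) := by
    refine intervalIntegral.hasSum_integral_of_dominated_convergence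
      (fun n _ => ‖taylorCoeff f n‖ * s ^ n) (fun n => ?_) (fun n => ?_) ?_ ?_ ?_
    · exact (by fun_prop : Continuous fun θ : ℝ => taylorCoeff f n * (s : ℂ) ^ n *
        Complex.exp (((n - k : ℤ) : ℂ) * (θ * Complex.I))).aestronglyMeasurable
    · refine .of_forall fun θ _ => le_of_eq ?_
      rw [norm_mul, hexp, norm_mul, norm_pow, Complex.norm_real, Real.norm_of_nonneg h0, mul_one]
    · exact .of_forall fun θ _ => hs
    · exact intervalIntegrable_const
    · refine .of_forall fun θ _ => ?_
      have := (hasSum_taylorCoeff hf (norm_mul_exp_lt_one h0 h1 θ)).mul_right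
        (Complex.exp (-k * (θ * Complex.I)))
      simpa only [hterm] using this
  rw [← key.tsum_eq]
  simp only [intervalIntegral.integral_const_mul, integral_exp_int]
  split_ifs with hk
  · lift k to ℕ using hk
    rw [tsum_eq_single k fun n hn => by rw [if_neg (by omega)]; simp]
    simp; ring
  · rw [mul_zero]
    refine (tsum_congr fun n => ?_).trans tsum_zero
    rw [if_neg (by omega)]; simp

theorem sum_sq_taylorCoeff_le {f : ℂ → ℂ} (hf : DifferentiableOn ℂ f (ball 0 1)) {s : ℝ}
    (h0 : 0 ≤ s) (h1 : s < 1) (N : Finset ℕ) :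
    2 * π * ∑ n ∈ N, ‖taylorCoeff f n‖ ^ 2 * s ^ (2 * n) ≤
      ∫ θ in (0 : ℝ)..2 * π, ‖f (s * Complex.exp (θ * Complex.I))‖ ^ 2 := by
  have hc := continuous_circle hf h0 h1
  have hL2 : MeasureTheory.MemLp (fun θ : ℝ => f (s * Complex.exp (θ * Complex.I))) 2
      (MeasureTheory.volume.restrict (Set.Ioc 0 (2 * π))) := by
    rw [MeasureTheory.memLp_two_iff_integrable_sq_norm hc.aestronglyMeasurable]
    have : Continuous fun θ : ℝ => ‖f (s * Complex.exp (θ * Complex.I))‖ ^ 2 := hc.norm.pow 2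
    exact (intervalIntegrable_iff_integrableOn_Ioc_of_le Real.two_pi_pos.le).1
      (this.intervalIntegrable 0 (2 * π))
  have hP := hasSum_sq_fourierCoeffOn Real.two_pi_pos hL2
  have hcoef : ∀ n : ℕ, fourierCoeffOn Real.two_pi_pos
      (fun θ : ℝ => f (s * Complex.exp (θ * Complex.I))) n = taylorCoeff f n * s ^ n := by
    intro n
    rw [fourierCoeffOn_eq_integral]
    have h2 := integral_circle_mul_exp hf h0 h1 n
    simp only [Int.natCast_nonneg, if_true, Int.toNat_natCast, Int.cast_natCast] at h2
    have h3 : ∀ θ : ℝ, fourier (-(n : ℤ)) (θ : AddCircle (2 * π - 0)) •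
        f (s * Complex.exp (θ * Complex.I)) = f (s * Complex.exp (θ * Complex.I)) *
        Complex.exp (-n * (θ * Complex.I)) := by
      intro θ
      rw [fourier_coe_apply, smul_eq_mul, mul_comm]
      congr 2
      push_cast
      have : (π : ℂ) ≠ 0 := by exact_mod_cast Real.pi_ne_zero
      field_simp
      ring
    simp only [h3, h2]
    have : (π : ℂ) ≠ 0 := by exact_mod_cast Real.pi_ne_zero
    simp
    field_simp
  have h4 := sum_le_hasSum (N.map ⟨fun n : ℕ => (n : ℤ), Nat.cast_injective⟩)
    (fun i _ => by positivity) hP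
  simp only [Finset.sum_map, Function.Embedding.coeFn_mk, hcoef, sub_zero, smul_eq_mul] at h4
  have h5 : ∀ n, ‖taylorCoeff f n * (s : ℂ) ^ n‖ ^ 2 = ‖taylorCoeff f n‖ ^ 2 * s ^ (2 * n) := by
    intro n
    rw [norm_mul, norm_pow, Complex.norm_real, Real.norm_of_nonneg h0]; ring
  simp only [h5] at h4
  have h6 := Real.two_pi_pos
  calc _ ≤ 2 * π * ((2 * π)⁻¹ * _) := by gcongr
    _ = _ := mul_inv_cancel_left₀ h6.ne' _

theorem norm_taylorCoeff_le_of_re_nonneg {p : ℂ → ℂ} (hp : DifferentiableOn ℂ p (ball 0 1))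
    (hre : ∀ z, ‖z‖ < 1 → 0 ≤ (p z).re) {n : ℕ} (hn : n ≠ 0) :
    ‖taylorCoeff p n‖ ≤ 2 * (p 0).re := by
  have key : ∀ s : ℝ, 0 ≤ s → s < 1 → ‖taylorCoeff p n‖ * s ^ n ≤ 2 * (p 0).re := by
    intro s h0 h1
    have hc := continuous_circle hp h0 h1
    set P : ℝ → ℂ := fun θ => p (s * Complex.exp (θ * Complex.I)) with hP
    have e1 := integral_circle_mul_exp hp h0 h1 n
    have e2 := integral_circle_mul_exp hp h0 h1 (-n)
    have e3 := integral_circle_mul_exp hp h0 h1 0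
    simp only [Int.natCast_nonneg, if_true, Int.toNat_natCast, Int.cast_natCast] at e1
    rw [if_neg (by omega), mul_zero] at e2
    simp [taylorCoeff_zero] at e3
    have e2' : ∫ θ in (0 : ℝ)..2 * π, (starRingEnd ℂ) (P θ) *
        Complex.exp (-n * (θ * Complex.I)) = 0 := by
      have := congrArg (starRingEnd ℂ) e2
      rw [← intervalIntegral.intervalIntegral_conj, map_zero] at this
      rw [← this]
      congr 1; ext θ
      simp [hP, ← Complex.exp_conj]
    have e4 : ∫ θ in (0 : ℝ)..2 * π, ((2 * (P θ).re : ℝ) : ℂ) *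
        Complex.exp (-n * (θ * Complex.I)) = 2 * π * (taylorCoeff p n * s ^ n) := by
      rw [← e1, ← add_zero (∫ θ in (0 : ℝ)..2 * π, p _ * _), ← e2',
        ← intervalIntegral.integral_add]
      · congr 1; ext θ
        rw [← add_mul, ← Complex.add_conj]
      · exact (hc.mul (by fun_prop)).intervalIntegrable _ _
      · exact ((Complex.continuous_conj.comp hc).mul (by fun_prop)).intervalIntegrable _ _
    have e5 : ∫ θ in (0 : ℝ)..2 * π, 2 * (P θ).re = 2 * (2 * π * (p 0).re) := by
      rw [intervalIntegral.integral_const_mul]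
      congr 1
      have := congrArg Complex.re e3
      rw [← Complex.reCLM_apply, ← ContinuousLinearMap.intervalIntegral_comp_comm _
        (hc.intervalIntegrable _ _)] at this
      simpa using this
    have e6 : ‖(2 * π * (taylorCoeff p n * s ^ n) : ℂ)‖ ≤ 2 * (2 * π * (p 0).re) := by
      rw [← e4, ← e5]
      refine intervalIntegral.norm_integral_le_of_norm_le Real.two_pi_pos.le
        (.of_forall fun θ _ => le_of_eq ?_) (Continuous.intervalIntegrable (by fun_prop) _ _)
      rw [norm_mul, show -(n : ℂ) * (θ * Complex.I) = ((-n * θ : ℝ) : ℂ) * Complex.I by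
        push_cast; ring, Complex.norm_exp_ofReal_mul_I, mul_one, Complex.norm_real,
        Real.norm_of_nonneg]
      have := hre _ (norm_mul_exp_lt_one h0 h1 θ)
      positivity
    simp only [norm_mul, norm_pow, Complex.norm_real, Real.norm_of_nonneg h0,
      Real.norm_of_nonneg Real.pi_pos.le, Complex.norm_ofNat] at e6
    have := Real.pi_pos
    nlinarith
  have hlim : Tendsto (fun s : ℝ => ‖taylorCoeff p n‖ * s ^ n) (𝓝[<] 1)
      (𝓝 (‖taylorCoeff p n‖ * 1 ^ n)) :=
    ((by fun_prop : Continuous fun s : ℝ => ‖taylorCoeff p n‖ * s ^ n).tendsto 1).mono_left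
      nhdsWithin_le_nhds
  rw [one_pow, mul_one] at hlim
  refine le_of_tendsto hlim ?_
  filter_upwards [Ioo_mem_nhdsLT (zero_lt_one' ℝ)] with s hs using key s hs.1.le hs.2

theorem norm_taylorCoeff_le_of_norm_le_one {φ : ℂ → ℂ} (hφ : DifferentiableOn ℂ φ (ball 0 1))
    (hle : ∀ z, ‖z‖ < 1 → ‖φ z‖ ≤ 1) {n : ℕ} (hn : n ≠ 0) :
    ‖taylorCoeff φ n‖ ≤ 2 * (1 - ‖φ 0‖) := by
  obtain ⟨u, hu, hu0⟩ : ∃ u : ℂ, ‖u‖ = 1 ∧ u * φ 0 = ‖φ 0‖ := by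
    by_cases h : φ 0 = 0
    · exact ⟨1, by simp [h]⟩
    · have hne : (‖φ 0‖ : ℂ) ≠ 0 := by simpa using h
      refine ⟨‖φ 0‖ / φ 0, by simp [h], by field_simp⟩
  have hcoef : taylorCoeff (fun z => 1 + -u * φ z) n = -u * taylorCoeff φ n := by
    have := taylorCoeff_eq_of_hasSum (f := fun z => 1 + -u * φ z)
      (a := fun k => (if k = 0 then 1 else 0) + -u * taylorCoeff φ k) one_pos fun z hz => by
        have h1 := (hasSum_taylorCoeff hφ hz).mul_left (-u)
        have h2 : HasSum (fun k : ℕ => if k = 0 then (1 : ℂ) else 0) 1 := hasSum_ite_eq 0 1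
        convert! h2.add h1 using 2 with k
        split_ifs with h <;> simp [h]; ring
    rw [this]; simp [hn]
  have h := norm_taylorCoeff_le_of_re_nonneg (p := fun z => 1 + -u * φ z) (by fun_prop)
    (fun z hz => by
      have h1 := Complex.re_le_norm (u * φ z)
      rw [norm_mul, hu, one_mul] at h1
      have := hle z hz
      rw [neg_mul, Complex.add_re, Complex.neg_re, Complex.one_re]
      linarith) hn
  rw [hcoef, norm_mul, norm_neg, hu, one_mul] at h
  rwa [neg_mul, hu0, Complex.add_re, Complex.neg_re, Complex.one_re, Complex.ofReal_re,
    ← sub_eq_add_neg] at h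

theorem taylorCoeff_id : taylorCoeff (fun z => z) = fun n => if n = 1 then 1 else 0 := by
  refine taylorCoeff_eq_of_hasSum one_pos fun z _ => ?_
  convert! hasSum_ite_eq 1 z using 2 with n
  split_ifs with h <;> simp [h]

theorem majorant_id (r : ℝ) : majorant (fun z => z) r = r := by
  unfold majorant
  rw [tsum_eq_single 1 (by intro n hn; simp [taylorCoeff_id, hn])]
  simp [taylorCoeff_id]

theorem majorant_le_one_of_norm_le_one {φ : ℂ → ℂ} (hφ : DifferentiableOn ℂ φ (ball 0 1))
    (hle : ∀ z, ‖z‖ < 1 → ‖φ z‖ ≤ 1) {r : ℝ} (h0 : 0 ≤ r) (h1 : r ≤ 1 / 3) :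
    majorant φ r ≤ 1 := by
  have hr : r < 1 := by linarith
  have hs := summable_majorant hφ h0 hr
  have ha := hle 0 (by simp)
  have hg := (hasSum_geometric_of_lt_one h0 hr).mul_left (2 * (1 - ‖φ 0‖) * r)
  unfold majorant
  rw [hs.tsum_eq_zero_add, taylorCoeff_zero, pow_zero, mul_one]
  have h2 : ∑' n, ‖taylorCoeff φ (n + 1)‖ * r ^ (n + 1) ≤ 2 * (1 - ‖φ 0‖) * r * (1 - r)⁻¹ := by
    rw [← hg.tsum_eq]
    refine Summable.tsum_le_tsum (fun n => ?_) ((summable_nat_add_iff 1).2 hs) hg.summable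
    rw [pow_succ, mul_assoc (2 * _), mul_comm r]
    gcongr
    exact norm_taylorCoeff_le_of_norm_le_one hφ hle (by omega)
  have h3 : r * (1 - r)⁻¹ ≤ 1 / 2 := by
    rw [← div_eq_mul_inv, div_le_iff₀ (by linarith)]; linarith
  nlinarith

theorem majorant_schwarz_le {w : ℂ → ℂ} (hw : DifferentiableOn ℂ w (ball 0 1)) (hw0 : w 0 = 0)
    (hw1 : ∀ z, ‖z‖ < 1 → ‖w z‖ < 1) {r : ℝ} (h0 : 0 ≤ r) (h1 : r ≤ 1 / 3) :
    majorant w r ≤ r := by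
  have hφ : DifferentiableOn ℂ (dslope w 0) (ball 0 1) :=
    (Complex.differentiableOn_dslope (ball_mem_nhds 0 one_pos)).2 hw
  have hle : ∀ z, ‖z‖ < 1 → ‖dslope w 0 z‖ ≤ 1 := fun z hz => by
    have := Complex.norm_dslope_le_div_of_mapsTo_ball (R₂ := 1) hw
      (fun x hx => by simpa [hw0] using (hw1 x (by simpa using hx)).le) (z := z) (by simpa using hz)
    simpa using this
  have heq : w = fun z => z * dslope w 0 z := by
    ext z
    have := sub_smul_dslope w 0 z
    simpa [hw0] using this.symm
  have hr : r < 1 := by linarith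
  calc majorant w r = majorant (fun z => z * dslope w 0 z) r := by rw [← heq]
    _ ≤ majorant (fun z => z) r * majorant (dslope w 0) r :=
      majorant_mul_le differentiableOn_id hφ h0 hr
    _ ≤ r * 1 := by
      rw [majorant_id]; gcongr
      exact majorant_le_one_of_norm_le_one hφ hle h0 h1
    _ = r := mul_one r

theorem volume_image_eq_lintegral_norm_sq {G G' : ℂ → ℂ} {A : Set ℂ} (hA : MeasurableSet A)
    (hG : ∀ z ∈ A, HasDerivAt G (G' z) z) (hinj : Set.InjOn G A) :
    MeasureTheory.volume (G '' A) = ∫⁻ z in A, ENNReal.ofReal (‖G' z‖ ^ 2) := by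
  rw [← MeasureTheory.lintegral_abs_det_fderiv_eq_addHaar_image MeasureTheory.volume hA
    (fun z hz => ((hG z hz).hasFDerivAt.restrictScalars ℝ).hasFDerivWithinAt) hinj]
  refine MeasureTheory.lintegral_congr fun z => ?_
  congr 1
  rw [ContinuousLinearMap.det, ContinuousLinearMap.coe_restrictScalars,
    LinearMap.det_restrictScalars]
  simp [Algebra.norm_complex_eq, Complex.normSq_eq_norm_sq]

/-- The real-linear map `W ↦ W + c * conj W`. -/
noncomputable def addMulConj (c : ℂ) : ℂ →ₗ[ℝ] ℂ :=
  LinearMap.id + (LinearMap.mulLeft ℝ c).comp Complex.conjAe.toLinearMap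

theorem addMulConj_apply (c w : ℂ) : addMulConj c w = w + c * (starRingEnd ℂ) w := rfl

theorem det_addMulConj (c : ℂ) : LinearMap.det (addMulConj c) = 1 - ‖c‖ ^ 2 := by
  rw [← LinearMap.det_toMatrix Complex.basisOneI, Matrix.det_fin_two]
  simp [LinearMap.toMatrix_apply, addMulConj_apply, ← Complex.normSq_eq_norm_sq,
    Complex.normSq_apply]
  ring

theorem le_lintegral_annulus {H : ℂ → ℂ} (hH : DifferentiableOn ℂ H (ball 0 1)) {ρ : ℝ}
    (h0 : 0 < ρ) (h1 : ρ < 1) (N : Finset ℕ) :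
    ENNReal.ofReal (2 * π * ∑ n ∈ N, ‖taylorCoeff H n‖ ^ 2 *
      ∫ s in ρ..1, s ^ (2 * n) / s ^ 3) ≤
    ∫⁻ z in {z : ℂ | ρ < ‖z‖ ∧ ‖z‖ < 1}, ENNReal.ofReal (‖H z / z ^ 2‖ ^ 2) := by
  have hmeas : MeasurableSet {z : ℂ | ρ < ‖z‖ ∧ ‖z‖ < 1} :=
    ((isOpen_lt continuous_const continuous_norm).inter
      (isOpen_lt continuous_norm continuous_const)).measurableSet
  have hcts : ∀ n : ℕ, ContinuousOn (fun s : ℝ => s ^ (2 * n) / s ^ 3) (Set.Icc ρ 1) := fun n =>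
    ContinuousOn.div (by fun_prop) (by fun_prop) fun s hs => by
      have := h0.trans_le hs.1
      positivity
  have hInt : ∀ n : ℕ, IntervalIntegrable (fun s : ℝ => s ^ (2 * n) / s ^ 3)
      MeasureTheory.volume ρ 1 := fun n =>
    (by rw [Set.uIcc_of_le h1.le]; exact hcts n : ContinuousOn _ (Set.uIcc ρ 1)).intervalIntegrable
  have e1 : 2 * π * ∑ n ∈ N, ‖taylorCoeff H n‖ ^ 2 * ∫ s in ρ..1, s ^ (2 * n) / s ^ 3 =
      ∫ s in Set.Ioo ρ 1, 2 * π * ∑ n ∈ N, ‖taylorCoeff H n‖ ^ 2 * (s ^ (2 * n) / s ^ 3) := by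
    rw [← MeasureTheory.integral_Ioc_eq_integral_Ioo, ← intervalIntegral.integral_of_le h1.le,
      intervalIntegral.integral_const_mul, intervalIntegral.integral_finsetSum]
    · simp only [intervalIntegral.integral_const_mul]
    · exact fun n _ => (hInt n).const_mul _
  have hii : MeasureTheory.IntegrableOn (fun s : ℝ => 2 * π * ∑ n ∈ N, ‖taylorCoeff H n‖ ^ 2 *
      (s ^ (2 * n) / s ^ 3)) (Set.Ioo ρ 1) := by
    refine (ContinuousOn.integrableOn_Icc ?_).mono_set Set.Ioo_subset_Icc_self
    exact continuousOn_const.mul (continuousOn_finsetSum _ fun n _ =>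
      continuousOn_const.mul (hcts n))
  rw [e1, MeasureTheory.ofReal_integral_eq_lintegral_ofReal hii]
  swap
  · refine (MeasureTheory.ae_restrict_iff' measurableSet_Ioo).2 (.of_forall fun s hs => ?_)
    have : 0 < s := h0.trans hs.1
    simp only [Pi.zero_apply]
    positivity
  rw [← MeasureTheory.lintegral_indicator hmeas, ← Complex.lintegral_comp_polarCoord_symm]
  have hz : ∀ p : ℝ × ℝ, Complex.polarCoord.symm p = p.1 * Complex.exp (p.2 * Complex.I) := by
    intro p
    rw [Complex.polarCoord_symm_apply, Complex.exp_mul_I, Complex.ofReal_cos, Complex.ofReal_sin]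
  set Φ : ℝ × ℝ → ℝ := fun p => ‖H (p.1 * Complex.exp (p.2 * Complex.I))‖ ^ 2 / p.1 ^ 3 with hΦ
  have hsub : Set.Ioo ρ 1 ×ˢ Set.Ioo (-π) π ⊆ polarCoord.target := fun p hp =>
    ⟨h0.trans hp.1.1, hp.2⟩
  have hΦc : ContinuousOn Φ (Set.Ioo ρ 1 ×ˢ Set.Ioo (-π) π) := by
    refine ContinuousOn.div (ContinuousOn.pow (ContinuousOn.norm ?_) 2) (by fun_prop) ?_
    · refine hH.continuousOn.comp (by fun_prop) fun p hp => ?_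
      simpa using norm_mul_exp_lt_one (h0.trans hp.1.1).le hp.1.2 p.2
    · intro p hp
      have := h0.trans hp.1.1
      positivity
  have hmeas2 : MeasurableSet (Set.Ioo ρ 1 ×ˢ Set.Ioo (-π) π) :=
    measurableSet_Ioo.prod measurableSet_Ioo
  calc _ ≤ ∫⁻ s in Set.Ioo ρ 1, ∫⁻ θ in Set.Ioo (-π) π, ENNReal.ofReal (Φ (s, θ)) := ?_
    _ = ∫⁻ p in Set.Ioo ρ 1 ×ˢ Set.Ioo (-π) π, ENNReal.ofReal (Φ p) := by
      rw [MeasureTheory.Measure.volume_eq_prod, ← MeasureTheory.Measure.prod_restrict,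
        MeasureTheory.lintegral_prod]
      rw [MeasureTheory.Measure.prod_restrict]
      exact (hΦc.aemeasurable hmeas2).ennreal_ofReal
    _ = ∫⁻ p in Set.Ioo ρ 1 ×ˢ Set.Ioo (-π) π, ENNReal.ofReal p.1 •
        {z : ℂ | ρ < ‖z‖ ∧ ‖z‖ < 1}.indicator (fun z => ENNReal.ofReal (‖H z / z ^ 2‖ ^ 2))
          (Complex.polarCoord.symm p) := by
      refine MeasureTheory.setLIntegral_congr_fun hmeas2 fun p hp => ?_
      have hp0 := h0.trans hp.1.1
      have hn : ‖(p.1 * Complex.exp (p.2 * Complex.I) : ℂ)‖ = p.1 := by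
        rw [norm_mul, Complex.norm_exp_ofReal_mul_I, mul_one, Complex.norm_real,
          Real.norm_of_nonneg hp0.le]
      rw [hz, Set.indicator_of_mem (by rw [Set.mem_ofPred_eq, hn]; exact hp.1), smul_eq_mul,
        ← ENNReal.ofReal_mul hp0.le, norm_div, norm_pow, hn, hΦ]
      congr 1
      field_simp
    _ ≤ _ := MeasureTheory.lintegral_mono_set hsub
  refine MeasureTheory.setLIntegral_mono' measurableSet_Ioo fun s hs => ?_
  have hs0 := h0.trans hs.1
  have hc := continuous_circle hH hs0.le hs.2
  have hc2 : Continuous fun θ => Φ (s, θ) := (hc.norm.pow 2).div_const (s ^ 3)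
  rw [← MeasureTheory.ofReal_integral_eq_lintegral_ofReal
    (hc2.integrableOn_Icc.mono_set Set.Ioo_subset_Icc_self) (.of_forall fun θ => by positivity)]
  refine ENNReal.ofReal_le_ofReal ?_
  have hper : Function.Periodic (fun θ => Φ (s, θ)) (2 * π) := fun θ => by
    simp only [hΦ]
    congr 5
    push_cast
    rw [add_mul, Complex.exp_periodic]
  have hshift := hper.intervalIntegral_add_eq (-π) 0
  rw [zero_add, show -π + 2 * π = π by ring] at hshift
  rw [← MeasureTheory.integral_Ioc_eq_integral_Ioo,
    ← intervalIntegral.integral_of_le (by linarith [Real.pi_pos]), hshift, hΦ]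
  simp only [intervalIntegral.integral_div]
  rw [le_div_iff₀ (by positivity)]
  refine le_trans (le_of_eq ?_) (sum_sq_taylorCoeff_le hH hs0.le hs.2 N)
  rw [mul_assoc, Finset.sum_mul]
  congr 1
  refine Finset.sum_congr rfl fun n _ => ?_
  field_simp

theorem taylorCoeff_deriv_mul_id_sub {U : ℂ → ℂ} (hU : DifferentiableOn ℂ U (ball 0 1)) :
    taylorCoeff (fun z => deriv U z * z - U z) = fun n : ℕ => ((n : ℂ) - 1) * taylorCoeff U n := by
  refine taylorCoeff_eq_of_hasSum one_pos fun z hz => ?_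
  have hd := (hasSum_taylorCoeff (hU.deriv isOpen_ball) hz).mul_right z
  have h1 : HasSum (fun n : ℕ => (n : ℂ) * taylorCoeff U n * z ^ n) (deriv U z * z) := by
    rw [← hasSum_nat_add_iff' 1]
    convert! hd using 1
    · ext n
      simp only [taylorCoeff, ← iteratedDeriv_succ']
      rw [Nat.factorial_succ]
      have : (n.factorial : ℂ) ≠ 0 := by exact_mod_cast n.factorial_ne_zero
      have : (n + 1 : ℂ) ≠ 0 := by exact_mod_cast n.succ_ne_zero
      push_cast
      field_simp
      ring
    · simp
  convert! h1.sub (hasSum_taylorCoeff hU hz) using 2 with n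
  ring

theorem exists_norm_sub_taylor_two_le {U : ℂ → ℂ} (hU : DifferentiableOn ℂ U (ball 0 1))
    (h0 : U 0 = 1) (h1 : taylorCoeff U 1 = 0) :
    ∃ K : ℝ, 0 ≤ K ∧ ∀ z : ℂ, ‖z‖ ≤ 1 / 2 →
      ‖U z - 1 - taylorCoeff U 2 * z ^ 2‖ ≤ K * ‖z‖ ^ 3 := by
  have hs : Summable fun n => ‖taylorCoeff U (n + 3)‖ * (1 / 2 : ℝ) ^ (n + 3) :=
    (summable_nat_add_iff 3).2 (summable_majorant hU (by norm_num) (by norm_num))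
  refine ⟨8 * ∑' n, ‖taylorCoeff U (n + 3)‖ * (1 / 2 : ℝ) ^ (n + 3), by positivity,
    fun z hz => ?_⟩
  have hz1 : ‖z‖ < 1 := by linarith
  have h2 := (hasSum_nat_add_iff' 3).2 (hasSum_taylorCoeff hU hz1)
  simp only [Finset.sum_range_succ, Finset.range_zero, Finset.sum_empty, taylorCoeff_zero, h0, h1]
    at h2
  have h3 := hs.hasSum.mul_left (8 * ‖z‖ ^ 3)
  have h4 := h2.norm_le_of_bounded h3 fun n => ?_
  · convert! h4 using 1
    · congr 1; ring
    · ring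
  · have hp : ‖z‖ ^ n ≤ (1 / 2 : ℝ) ^ n := by gcongr
    rw [norm_mul, norm_pow]
    calc ‖taylorCoeff U (n + 3)‖ * ‖z‖ ^ (n + 3)
        = ‖z‖ ^ 3 * (‖taylorCoeff U (n + 3)‖ * ‖z‖ ^ n) := by ring
      _ ≤ ‖z‖ ^ 3 * (‖taylorCoeff U (n + 3)‖ * (1 / 2 : ℝ) ^ n) := by gcongr
      _ = _ := by ring

theorem exists_norm_div_id_le {U : ℂ → ℂ} (hU : DifferentiableOn ℂ U (ball 0 1))
    (h0 : U 0 = 1) (hinj : Set.InjOn (fun z => U z / z) {z | 0 < ‖z‖ ∧ ‖z‖ < 1}) :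
    ∃ M : ℝ, 0 ≤ M ∧ ∀ z : ℂ, 1 / 2 ≤ ‖z‖ → ‖z‖ < 1 → ‖U z / z‖ ≤ M := by
  have hUan : AnalyticAt ℂ U 0 := hU.analyticAt (ball_mem_nhds 0 one_pos)
  have hne : ∀ᶠ z in 𝓝 (0 : ℂ), U z ≠ 0 :=
    hUan.continuousAt.eventually_ne (by rw [h0]; exact one_ne_zero)
  have hstrict : HasStrictDerivAt (fun z => z / U z) 1 0 := by
    have := (hasStrictDerivAt_id (0 : ℂ)).fun_div hUan.hasStrictDerivAt (by simp [h0])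
    simpa [h0] using this
  have hmap := hstrict.map_nhds_eq one_ne_zero
  have hmem : {z : ℂ | U z ≠ 0 ∧ ‖z‖ < 1 / 2} ∈ 𝓝 (0 : ℂ) := by
    filter_upwards [hne, ball_mem_nhds (0 : ℂ) (by norm_num : (0 : ℝ) < 1 / 2)] with z h1 h2
    exact ⟨h1, by simpa using h2⟩
  have himg := image_mem_map (m := fun z => z / U z) hmem
  rw [hmap] at himg
  simp only [zero_div] at himg
  obtain ⟨ε, hε, hball⟩ := Metric.mem_nhds_iff.1 himg
  refine ⟨ε⁻¹, by positivity, fun z hz hz1 => ?_⟩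
  by_contra! hlt
  have hGpos : 0 < ‖U z / z‖ := (inv_pos.2 hε).trans hlt
  obtain ⟨y, ⟨hyU, hy⟩, hyeq⟩ := hball (show (U z / z)⁻¹ ∈ ball 0 ε by
    rw [mem_ball_zero_iff, norm_inv]
    exact inv_lt_of_inv_lt₀ hε hlt)
  have hy0 : y ≠ 0 := by
    rintro rfl
    simp only [zero_div] at hyeq
    exact (inv_ne_zero (norm_pos_iff.1 hGpos)) hyeq.symm
  have : y = z := hinj ⟨norm_pos_iff.2 hy0, by linarith⟩ ⟨by linarith, hz1⟩ (by
    have := congrArg (·⁻¹) hyeq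
    simpa using this)
  subst this
  linarith

theorem exists_norm_addMulConj_le {U : ℂ → ℂ} (hU : DifferentiableOn ℂ U (ball 0 1))
    (h0 : U 0 = 1) (h1 : taylorCoeff U 1 = 0)
    (hinj : Set.InjOn (fun z => U z / z) {z | 0 < ‖z‖ ∧ ‖z‖ < 1}) :
    ∃ K : ℝ, ∀ᶠ ρ : ℝ in 𝓝[>] 0, ∀ z : ℂ, ρ < ‖z‖ → ‖z‖ < 1 →
      ‖addMulConj (-(taylorCoeff U 2 * ρ ^ 2)) (U z / z)‖ ≤ 1 / ρ + K * ρ ^ 2 := by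
  obtain ⟨K, hK0, hK⟩ := exists_norm_sub_taylor_two_le hU h0 h1
  obtain ⟨M, hM0, hM⟩ := exists_norm_div_id_le hU h0 hinj
  set b := taylorCoeff U 2 with hb
  have hb0 := norm_nonneg b
  refine ⟨4 * K + ‖b‖ * (‖b‖ + K), ?_⟩
  have hL : 0 < ‖b‖ + 2 * K + M * (1 + ‖b‖) + 1 := by positivity
  filter_upwards [Ioo_mem_nhdsGT (inv_pos.2 hL)] with ρ hρ z hz hz1
  have hρ0 := hρ.1
  have hρL : ‖b‖ + 2 * K + M * (1 + ‖b‖) + 1 ≤ 1 / ρ := by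
    rw [one_div]; exact ((lt_inv_comm₀ hρ0 hL).1 hρ.2).le
  have hMb : 0 ≤ M * (1 + ‖b‖) := by positivity
  have hρ1 : ρ ≤ 1 := by
    have : 1 ≤ 1 / ρ := by linarith
    rwa [le_div_iff₀ hρ0, one_mul] at this
  have hρsq : ρ ^ 2 ≤ 1 := by nlinarith
  have hKρ : 0 ≤ (4 * K + ‖b‖ * (‖b‖ + K)) * ρ ^ 2 := by positivity
  rw [addMulConj_apply]
  have hz0 : 0 < ‖z‖ := hρ0.trans hz
  have hzne : z ≠ 0 := norm_pos_iff.1 hz0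
  rcases le_total (1 / 2) ‖z‖ with hfar | hnear
  · have hG := hM z hfar hz1
    calc ‖U z / z + -(b * ρ ^ 2) * (starRingEnd ℂ) (U z / z)‖
        ≤ ‖U z / z‖ + ‖b‖ * ρ ^ 2 * ‖U z / z‖ := by
          refine (norm_add_le _ _).trans_eq ?_
          rw [norm_mul, norm_neg, norm_mul, RCLike.norm_conj, norm_pow, Complex.norm_real,
            Real.norm_of_nonneg hρ0.le]
      _ ≤ M + ‖b‖ * 1 * M := by gcongr
      _ ≤ _ := by linarith
  · set s := ‖z‖ with hs
    set R := U z - 1 - b * z ^ 2 with hR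
    have hRb := hK z hnear
    have hzc : z * (starRingEnd ℂ) z = (s : ℂ) ^ 2 := by
      rw [Complex.mul_conj, Complex.normSq_eq_norm_sq, hs]; push_cast; ring
    have hzcne : (starRingEnd ℂ) z ≠ 0 := by simpa using hzne
    have hUz : U z = 1 + b * z ^ 2 + R := by rw [hR]; ring
    have hdec : U z / z + -(b * ρ ^ 2) * (starRingEnd ℂ) (U z / z) =
        1 / z + b * z * (((s ^ 2 - ρ ^ 2) / s ^ 2 : ℝ) : ℂ) + R / z
          + -(b * ρ ^ 2) * (starRingEnd ℂ) (b * z + R / z) := by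
      have hsne : (s : ℂ) ≠ 0 := by exact_mod_cast hz0.ne'
      have h3 : z / (s : ℂ) ^ 2 = 1 / (starRingEnd ℂ) z := by
        rw [← hzc]; field_simp
      have h4 : U z / z = 1 / z + (b * z + R / z) := by rw [hUz]; field_simp; ring
      rw [h4, map_add, map_div₀, map_one]
      push_cast
      have h5 : b * z * (((s : ℂ) ^ 2 - ρ ^ 2) / (s : ℂ) ^ 2) =
        b * z - b * ρ ^ 2 * (1 / (starRingEnd ℂ) z) := by
        rw [← h3]; field_simp
      rw [h5]; ring
    have hRz : ‖R / z‖ ≤ K * s ^ 2 := by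
      rw [norm_div, div_le_iff₀ hz0]
      calc _ ≤ _ := hRb
        _ = _ := by ring
    have hs2 : s ^ 2 ≤ s := by nlinarith
    have hfrac : 0 ≤ (s ^ 2 - ρ ^ 2) / s ^ 2 := by
      apply div_nonneg <;> nlinarith
    have hbound : ‖U z / z + -(b * ρ ^ 2) * (starRingEnd ℂ) (U z / z)‖ ≤
        1 / s + ‖b‖ * s * ((s ^ 2 - ρ ^ 2) / s ^ 2) + K * s ^ 2
          + ‖b‖ * ρ ^ 2 * (‖b‖ + K) := by
      rw [hdec]
      refine (norm_add_le _ _).trans (add_le_add ((norm_add_le _ _).trans (add_le_add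
        ((norm_add_le _ _).trans (add_le_add ?_ ?_)) hRz)) ?_)
      · simp [hs]
      · rw [norm_mul, norm_mul, Complex.norm_real, Real.norm_of_nonneg hfrac]
      · rw [norm_mul, norm_neg, norm_mul, RCLike.norm_conj, norm_pow, Complex.norm_real,
            Real.norm_of_nonneg hρ0.le]
        gcongr
        refine (norm_add_le _ _).trans (add_le_add ?_ (hRz.trans ?_))
        · rw [norm_mul]; nlinarith
        · nlinarith
    refine hbound.trans ?_
    have hkey : 1 / s + ‖b‖ * s * ((s ^ 2 - ρ ^ 2) / s ^ 2) =
        1 / ρ - (s - ρ) / s * (1 / ρ - ‖b‖ * (s + ρ)) := by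
      field_simp; ring
    rw [hkey]
    have hbr : 2 * K ≤ 1 / ρ - ‖b‖ * (s + ρ) := by nlinarith
    have hfr : 0 ≤ (s - ρ) / s := div_nonneg (by linarith) hz0.le
    rcases le_total s (2 * ρ) with h2 | h2
    · have : K * s ^ 2 ≤ K * (2 * ρ) ^ 2 := by gcongr
      have : 0 ≤ (s - ρ) / s * (1 / ρ - ‖b‖ * (s + ρ)) := mul_nonneg hfr (by linarith)
      nlinarith
    · have hhalf : 1 / 2 ≤ (s - ρ) / s := by rw [le_div_iff₀ hz0]; linarith
      have h6 : 1 / 2 * (2 * K) ≤ (s - ρ) / s * (1 / ρ - ‖b‖ * (s + ρ)) := by gcongr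
      have h7 : K * s ^ 2 ≤ K := by nlinarith
      have h8 : 0 ≤ 4 * K * ρ ^ 2 := by positivity
      nlinarith

theorem one_sub_mul_volume_le {G : ℂ → ℂ} {A : Set ℂ} {c : ℂ} {R : ℝ} (hc : ‖c‖ ≤ 1)
    (hR : 0 ≤ R) (h : ∀ z ∈ A, ‖addMulConj c (G z)‖ ≤ R) {a : ℝ}
    (ha : ENNReal.ofReal a ≤ MeasureTheory.volume (G '' A)) :
    (1 - ‖c‖ ^ 2) * a ≤ π * R ^ 2 := by
  have hc2 : 0 ≤ 1 - ‖c‖ ^ 2 := by nlinarith [norm_nonneg c]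
  have h1 := MeasureTheory.Measure.addHaar_image_linearMap MeasureTheory.volume (addMulConj c)
    (G '' A)
  rw [det_addMulConj, abs_of_nonneg hc2] at h1
  have h2 : addMulConj c '' (G '' A) ⊆ closedBall 0 R := by
    rintro _ ⟨_, ⟨z, hz, rfl⟩, rfl⟩
    simpa using h z hz
  have h3 := MeasureTheory.measure_mono (μ := MeasureTheory.volume) h2
  have h4 : MeasureTheory.volume (closedBall (0 : ℂ) R) = ENNReal.ofReal (π * R ^ 2) := by
    rw [Complex.volume_closedBall, mul_comm, ENNReal.ofReal_mul Real.pi_pos.le,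
      ENNReal.ofReal_pow hR]
    congr 1
    rw [← NNReal.coe_real_pi, ENNReal.ofReal_coe_nnreal]
  rw [h1, h4] at h3
  have h5 : ENNReal.ofReal ((1 - ‖c‖ ^ 2) * a) ≤ ENNReal.ofReal (π * R ^ 2) := by
    rw [ENNReal.ofReal_mul hc2]
    exact le_trans (by gcongr) h3
  exact (ENNReal.ofReal_le_ofReal_iff (by positivity)).1 h5

theorem integral_pow_div_pow_three_zero {ρ : ℝ} (h0 : 0 < ρ) (h1 : ρ < 1) :
    ∫ s in ρ..1, s ^ (2 * 0) / s ^ 3 = (1 / ρ ^ 2 - 1) / 2 := by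
  have h2 : ∀ s : ℝ, s ^ (2 * 0) / s ^ 3 = s ^ (-3 : ℤ) := fun s => by
    rw [zpow_neg]; norm_cast; simp
  simp only [h2]
  rw [integral_zpow (Or.inr ⟨by norm_num, by
    rw [Set.uIcc_of_le h1.le]; exact fun h => absurd h.1 (by linarith)⟩)]
  rw [show (-3 : ℤ) + 1 = -2 by norm_num, one_zpow, zpow_neg,
    show ρ ^ (2 : ℤ) = ρ ^ 2 by norm_cast]
  push_cast
  ring

theorem integral_pow_div_pow_three_add_two {ρ : ℝ} (h0 : 0 < ρ) (h1 : ρ < 1) (m : ℕ) :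
    ∫ s in ρ..1, s ^ (2 * (m + 2)) / s ^ 3 = (1 - ρ ^ (2 * m + 2)) / (2 * (m + 1)) := by
  have h2 : ∫ s in ρ..1, s ^ (2 * (m + 2)) / s ^ 3 = ∫ s in ρ..1, s ^ (2 * m + 1) := by
    refine intervalIntegral.integral_congr fun s hs => ?_
    rw [Set.uIcc_of_le h1.le] at hs
    have : s ≠ 0 := (h0.trans_le hs.1).ne'
    field_simp
    ring
  rw [h2, integral_pow]
  push_cast
  rw [one_pow]
  congr 1
  ring

theorem area_theorem {U : ℂ → ℂ} (hU : DifferentiableOn ℂ U (ball 0 1))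
    (h0 : U 0 = 1) (h1 : taylorCoeff U 1 = 0)
    (hinj : Set.InjOn (fun z => U z / z) {z | 0 < ‖z‖ ∧ ‖z‖ < 1}) (n : ℕ) :
    ∑ m ∈ Finset.range n, (m + 1) * ‖taylorCoeff U (m + 2)‖ ^ 2 ≤ 1 := by
  obtain ⟨K, hK⟩ := exists_norm_addMulConj_le hU h0 h1 hinj
  set b := taylorCoeff U 2 with hb
  set S : ℝ → ℝ := fun ρ => ∑ m ∈ Finset.range n,
    (m + 1) * ‖taylorCoeff U (m + 2)‖ ^ 2 * (1 - ρ ^ (2 * m + 2)) with hS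
  have key : ∀ᶠ ρ : ℝ in 𝓝[>] 0, S ρ - 1 ≤
      2 * K * ρ + K ^ 2 * ρ ^ 4 + ‖b‖ ^ 2 * ρ ^ 2 + ‖b‖ ^ 2 * ρ ^ 4 * (S ρ - 1) := by
    have hpos : 0 < (‖b‖ + 1)⁻¹ := by positivity
    filter_upwards [hK, Ioo_mem_nhdsGT hpos] with ρ hρ hρI
    have hρ0 := hρI.1
    have hρ1 : ρ < 1 := hρI.2.trans_le (inv_le_one_of_one_le₀ (by simp))
    have hbρ : ‖b‖ * ρ ≤ 1 := by
      have := (lt_inv_comm₀ hρ0 (by positivity)).1 hρI.2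
      rw [← one_div, lt_div_iff₀ hρ0] at this
      nlinarith
    have hlow := le_lintegral_annulus (H := fun z => deriv U z * z - U z)
      (((hU.deriv isOpen_ball).mul differentiableOn_id).sub hU) hρ0 hρ1 (Finset.range (n + 2))
    have hinjρ : Set.InjOn (fun z => U z / z) {z : ℂ | ρ < ‖z‖ ∧ ‖z‖ < 1} :=
      hinj.mono (by intro z hz; exact ⟨hρ0.trans hz.1, hz.2⟩)
    have hvol := volume_image_eq_lintegral_norm_sq (G := fun z => U z / z)
      (G' := fun z => (deriv U z * z - U z) / z ^ 2) (A := {z : ℂ | ρ < ‖z‖ ∧ ‖z‖ < 1})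
      ((isOpen_lt continuous_const continuous_norm).inter
        (isOpen_lt continuous_norm continuous_const)).measurableSet (fun z hz => by
          have hz0 : z ≠ 0 := norm_pos_iff.1 (hρ0.trans hz.1)
          have := (hU.differentiableAt (isOpen_ball.mem_nhds (by simpa using hz.2))).hasDerivAt
          simpa using this.fun_div (hasDerivAt_id z) hz0)
      hinjρ
    rw [← hvol] at hlow
    have hcn : ‖-(b * (ρ : ℂ) ^ 2)‖ = ‖b‖ * ρ ^ 2 := by
      rw [norm_neg, norm_mul, norm_pow, Complex.norm_real, Real.norm_of_nonneg hρ0.le]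
    have hR : 0 ≤ 1 / ρ + K * ρ ^ 2 := by
      have := hρ (((ρ + 1) / 2 : ℝ) : ℂ) (by
        rw [Complex.norm_real, Real.norm_of_nonneg (by linarith)]; linarith) (by
        rw [Complex.norm_real, Real.norm_of_nonneg (by linarith)]; linarith)
      exact (norm_nonneg _).trans this
    have hfin := one_sub_mul_volume_le (c := -(b * (ρ : ℂ) ^ 2)) (by rw [hcn]; nlinarith) hR
      (fun z hz => hρ z hz.1 hz.2) hlow
    rw [hcn, taylorCoeff_deriv_mul_id_sub hU, Finset.sum_range_succ', Finset.sum_range_succ',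
      integral_pow_div_pow_three_zero hρ0 hρ1] at hfin
    have hterm : ∀ m : ℕ, ‖(((m + 1 + 1 : ℕ) : ℂ) - 1) * taylorCoeff U (m + 1 + 1)‖ ^ 2 *
        ∫ s in ρ..1, s ^ (2 * (m + 1 + 1)) / s ^ 3 =
        (m + 1) * ‖taylorCoeff U (m + 2)‖ ^ 2 * (1 - ρ ^ (2 * m + 2)) / 2 := fun m => by
      rw [integral_pow_div_pow_three_add_two hρ0 hρ1, norm_mul]
      have : ‖((m + 1 + 1 : ℕ) : ℂ) - 1‖ = (m : ℝ) + 1 := by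
        rw [show ((m + 1 + 1 : ℕ) : ℂ) - 1 = ((m + 1 : ℕ) : ℂ) by push_cast; ring,
          Complex.norm_natCast]
        push_cast; rfl
      rw [this]
      field_simp
    simp only [hterm, ← Finset.sum_div] at hfin
    have hSρ : ∑ i ∈ Finset.range n, (i + 1) * ‖taylorCoeff U (i + 2)‖ ^ 2 *
      (1 - ρ ^ (2 * i + 2)) = S ρ := rfl
    rw [hSρ, zero_add, h1, mul_zero, norm_zero, zero_pow two_ne_zero, zero_mul, taylorCoeff_zero,
      h0, add_zero, Nat.cast_zero, zero_sub, mul_one, norm_neg, norm_one, one_pow, one_mul] at hfin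
    have h4 : π * ((1 - (‖b‖ * ρ ^ 2) ^ 2) * (S ρ + 1 / ρ ^ 2 - 1)) ≤
        π * (1 / ρ + K * ρ ^ 2) ^ 2 := le_trans (le_of_eq (by ring)) hfin
    have h5 := le_of_mul_le_mul_left h4 Real.pi_pos
    have h6 : (1 / ρ + K * ρ ^ 2) ^ 2 = 1 / ρ ^ 2 + 2 * K * ρ + K ^ 2 * ρ ^ 4 := by
      field_simp; ring
    have h7 : (1 - (‖b‖ * ρ ^ 2) ^ 2) * (S ρ + 1 / ρ ^ 2 - 1) =
        S ρ - 1 + 1 / ρ ^ 2 - ‖b‖ ^ 2 * ρ ^ 4 * (S ρ - 1) - ‖b‖ ^ 2 * ρ ^ 2 := by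
      field_simp; ring
    linarith
  have hcS : Continuous S := by fun_prop
  have h3 := le_of_tendsto_of_tendsto
    (((by fun_prop : Continuous fun ρ => S ρ - 1).tendsto 0).mono_left nhdsWithin_le_nhds)
    (((by fun_prop : Continuous fun ρ => 2 * K * ρ + K ^ 2 * ρ ^ 4 + ‖b‖ ^ 2 * ρ ^ 2 +
      ‖b‖ ^ 2 * ρ ^ 4 * (S ρ - 1)).tendsto 0).mono_left nhdsWithin_le_nhds) key
  simpa [hS] using h3

theorem deriv_ne_zero_of_injOn {f : ℂ → ℂ} {z₀ : ℂ} {s : Set ℂ} (hf : AnalyticAt ℂ f z₀)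
    (hs : s ∈ 𝓝 z₀) (hinj : Set.InjOn f s) : deriv f z₀ ≠ 0 := by
  have hz₀ : z₀ ∈ s := mem_of_mem_nhds hs
  have hnz : ¬ ∀ᶠ z in 𝓝 z₀, f z - f z₀ = 0 := fun h => by
    have h1 : ∀ᶠ z in 𝓝[≠] z₀, False := by
      filter_upwards [nhdsWithin_le_nhds h, nhdsWithin_le_nhds hs, self_mem_nhdsWithin]
        with z h2 h3 h4
      exact h4 (hinj h3 hz₀ (sub_eq_zero.1 h2))
    simp at h1
    exact (NormedField.nhdsNE_neBot z₀).ne h1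
  obtain ⟨n, g, hg, hg0, hfg⟩ :=
    (hf.fun_sub analyticAt_const).exists_eventuallyEq_pow_smul_nonzero_iff.2 hnz
  have hn0 : n ≠ 0 := by
    rintro rfl
    have := hfg.self_of_nhds
    simp at this
    exact hg0 this.symm
  rcases eq_or_ne n 1 with rfl | hn1
  · have h1 : HasDerivAt (fun z => f z - f z₀) (g z₀) z₀ := by
      refine HasDerivAt.congr_of_eventuallyEq ?_ hfg
      have := ((hasDerivAt_id z₀).sub_const z₀).fun_mul hg.differentiableAt.hasDerivAt
      simpa using this
    rw [← deriv_sub_const (f z₀), h1.deriv]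
    exact hg0
  exfalso
  have hn : (n : ℂ) ≠ 0 := by exact_mod_cast hn0
  set h : ℂ → ℂ := fun z => (z - z₀) * (g z / g z₀) ^ (1 / n : ℂ) with hh
  have hpow : ∀ᶠ z in 𝓝 z₀, h z ^ n * g z₀ = f z - f z₀ := by
    filter_upwards [hfg] with z hz
    rw [hz, hh, smul_eq_mul, mul_pow, one_div, Complex.cpow_nat_inv_pow _ hn0]
    field_simp
  have hstrict : HasStrictDerivAt h 1 z₀ := by
    have h1 : AnalyticAt ℂ (fun z => g z / g z₀) z₀ := hg.fun_div analyticAt_const hg0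
    have h2 : AnalyticAt ℂ (fun z => (g z / g z₀) ^ (1 / n : ℂ)) z₀ :=
      h1.cpow analyticAt_const (by simp [hg0])
    have := HasStrictDerivAt.fun_mul
      ((hasStrictDerivAt_id z₀).sub_const z₀ : HasStrictDerivAt (fun z => z - z₀) 1 z₀)
      h2.hasStrictDerivAt
    simpa [hg0, hh] using this
  have hmap := hstrict.map_nhds_eq one_ne_zero
  have hT : h '' (s ∩ {z | h z ^ n * g z₀ = f z - f z₀}) ∈ 𝓝 (0 : ℂ) := by
    have := image_mem_map (m := h) (inter_mem hs hpow)
    rw [hmap] at this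
    simpa [hh] using this
  set ζ := Complex.exp (2 * π * Complex.I / n) with hζ
  have hprim : IsPrimitiveRoot ζ n := Complex.isPrimitiveRoot_exp n hn0
  have hrot : ∀ᶠ w in 𝓝 (0 : ℂ), ζ * w ∈ h '' (s ∩ {z | h z ^ n * g z₀ = f z - f z₀}) := by
    have : Tendsto (fun w => ζ * w) (𝓝 0) (𝓝 0) := by
      simpa using (continuous_const_mul ζ).tendsto 0
    exact this hT
  have hfalse : ∀ᶠ w in 𝓝[≠] (0 : ℂ), False := by
    filter_upwards [nhdsWithin_le_nhds hT, nhdsWithin_le_nhds hrot, self_mem_nhdsWithin]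
      with w h1 h2 h3
    obtain ⟨z1, ⟨hz1, hz1'⟩, e1⟩ := h1
    obtain ⟨z2, ⟨hz2, hz2'⟩, e2⟩ := h2
    simp only [Set.mem_ofPred_eq] at hz1' hz2'
    rw [e1] at hz1'
    rw [e2, mul_pow, hprim.pow_eq_one, one_mul, hz1', sub_left_inj] at hz2'
    have h12 := hinj hz1 hz2 hz2'
    rw [← h12, e1] at e2
    have : ζ = 1 := (mul_right_cancel₀ h3 (by rw [one_mul]; exact e2)).symm
    exact hn1 (hprim.unique (this ▸ IsPrimitiveRoot.one))
  simp at hfalse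
  exact (NormedField.nhdsNE_neBot (0 : ℂ)).ne hfalse

theorem exists_sq_eq_of_ne_zero {q : ℂ → ℂ} (hq : DifferentiableOn ℂ q (ball 0 1))
    (hne : ∀ z ∈ ball (0 : ℂ) 1, q z ≠ 0) (h0 : q 0 = 1) :
    ∃ C : ℂ → ℂ, DifferentiableOn ℂ C (ball 0 1) ∧ C 0 = 1 ∧
      ∀ z ∈ ball (0 : ℂ) 1, C z ≠ 0 ∧ C z ^ 2 = q z := by
  obtain ⟨l, hl0, hl⟩ := (((hq.deriv isOpen_ball).fun_div hq hne).isExactOn_ball).with_val_at 0 0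
  have hd : ∀ z ∈ ball (0 : ℂ) 1, HasDerivAt (fun z => Complex.exp (-l z) * q z) 0 z := by
    intro z hz
    have h1 := (hl z hz).fun_neg.cexp.fun_mul
      (hq.differentiableAt (isOpen_ball.mem_nhds hz)).hasDerivAt
    convert! h1 using 1
    have := hne z hz
    field_simp
    ring
  have hconst : ∀ z ∈ ball (0 : ℂ) 1, Complex.exp (-l z) * q z = 1 := by
    intro z hz
    have := (convex_ball (0 : ℂ) 1).is_const_of_fderivWithin_eq_zero (𝕜 := ℂ)
      (f := fun z => Complex.exp (-l z) * q z)
      (fun z hz => (hd z hz).differentiableAt.differentiableWithinAt)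
      (fun z hz => by
        rw [fderivWithin_of_isOpen isOpen_ball hz]
        ext
        simp [(hd z hz).deriv]) hz (mem_ball_self one_pos)
    simpa [hl0, h0] using this
  refine ⟨fun z => Complex.exp (l z / 2), fun z hz => ?_, by simp [hl0], fun z hz =>
    ⟨Complex.exp_ne_zero _, ?_⟩⟩
  · exact ((hl z hz).differentiableAt.div_const 2).cexp.differentiableWithinAt
  · rw [← Complex.exp_nat_mul]
    have h1 := hconst z hz
    rw [Complex.exp_neg, inv_mul_eq_one₀ (Complex.exp_ne_zero _)] at h1
    rw [← h1]
    congr 1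
    push_cast
    ring

theorem taylorCoeff_congr {f g : ℂ → ℂ} (hg : DifferentiableOn ℂ g (ball 0 1))
    (h : Set.EqOn f g (ball 0 1)) : taylorCoeff f = taylorCoeff g :=
  taylorCoeff_eq_of_hasSum one_pos fun z hz => by
    rw [h (by simpa using hz)]
    exact hasSum_taylorCoeff hg hz

/-- Normalized univalent functions on the unit disk. -/
structure IsSchlicht (f : ℂ → ℂ) : Prop where
  differentiableOn : DifferentiableOn ℂ f (ball 0 1)
  injOn : Set.InjOn f (ball 0 1)
  map_zero : f 0 = 0
  deriv_zero : deriv f 0 = 1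

theorem taylorCoeff_comp_sq {B : ℂ → ℂ} (hB : DifferentiableOn ℂ B (ball 0 1)) :
    taylorCoeff (fun z => B (z ^ 2)) = fun n => if 2 ∣ n then taylorCoeff B (n / 2) else 0 := by
  refine taylorCoeff_eq_of_hasSum one_pos fun z hz => ?_
  have hz2 : ‖z ^ 2‖ < 1 := by rw [norm_pow]; exact pow_lt_one₀ (norm_nonneg z) hz two_ne_zero
  have hi : Function.Injective fun n : ℕ => 2 * n := fun a b h => by simpa using h
  rw [← hi.hasSum_iff]
  · convert! hasSum_taylorCoeff hB hz2 using 2 with n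
    simp [pow_mul]
  · intro n hn
    rw [if_neg, zero_mul]
    rintro ⟨k, rfl⟩
    exact hn ⟨k, rfl⟩

theorem IsSchlicht.exists_inv_sqrt {f : ℂ → ℂ} (hf : IsSchlicht f) :
    ∃ B : ℂ → ℂ, DifferentiableOn ℂ B (ball 0 1) ∧ B 0 = 1 ∧
      (∀ z ∈ ball (0 : ℂ) 1, B z ≠ 0 ∧ f z * B z ^ 2 = z) ∧
      ∀ n, ∑ m ∈ Finset.range n, (2 * m + 1) * ‖taylorCoeff B (m + 1)‖ ^ 2 ≤ 1 := by
  have hq : DifferentiableOn ℂ (dslope f 0) (ball 0 1) :=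
    (Complex.differentiableOn_dslope (ball_mem_nhds 0 one_pos)).2 hf.differentiableOn
  have hfq : ∀ z, f z = z * dslope f 0 z := fun z => by
    have := sub_smul_dslope f 0 z
    simpa [hf.map_zero] using this.symm
  have hq0 : dslope f 0 0 = 1 := by rw [dslope_same, hf.deriv_zero]
  have h0mem : (0 : ℂ) ∈ ball (0 : ℂ) 1 := mem_ball_self one_pos
  have hqne : ∀ z ∈ ball (0 : ℂ) 1, dslope f 0 z ≠ 0 := fun z hz h => by
    have h1 : f z = f 0 := by rw [hfq z, h, mul_zero, hf.map_zero]
    have h2 := hf.injOn hz h0mem h1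
    rw [h2, hq0] at h
    exact one_ne_zero h
  obtain ⟨C, hC, hC0, hCq⟩ := exists_sq_eq_of_ne_zero hq hqne hq0
  set B : ℂ → ℂ := fun z => 1 / C z with hBdef
  have hB : DifferentiableOn ℂ B (ball 0 1) :=
    (differentiableOn_const 1).fun_div hC fun z hz => (hCq z hz).1
  have hBne : ∀ z ∈ ball (0 : ℂ) 1, B z ≠ 0 ∧ f z * B z ^ 2 = z := fun z hz => by
    refine ⟨one_div_ne_zero (hCq z hz).1, ?_⟩
    have h1 := (hCq z hz).1
    rw [hfq z, ← (hCq z hz).2, hBdef]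
    field_simp
  refine ⟨B, hB, by simp [hBdef, hC0], hBne, fun n => ?_⟩
  have hsqmem : ∀ z : ℂ, ‖z‖ < 1 → z ^ 2 ∈ ball (0 : ℂ) 1 := fun z hz => by
    rw [mem_ball_zero_iff, norm_pow]
    exact pow_lt_one₀ (norm_nonneg z) hz two_ne_zero
  have hU : DifferentiableOn ℂ (fun z => B (z ^ 2)) (ball 0 1) :=
    hB.fun_comp (by fun_prop) fun z hz => hsqmem z (by simpa using hz)
  have hcoef := taylorCoeff_comp_sq hB
  have harea := area_theorem hU (by simp [hBdef, hC0]) (by rw [hcoef]; simp) (by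
    intro z hz y hy hzy
    simp only at hzy
    have hz0 : z ≠ 0 := norm_pos_iff.1 hz.1
    have hy0 : y ≠ 0 := norm_pos_iff.1 hy.1
    obtain ⟨hz1, hz2⟩ := hBne _ (hsqmem z hz.2)
    obtain ⟨hy1, hy2⟩ := hBne _ (hsqmem y hy.2)
    have h1 : f (z ^ 2) = f (y ^ 2) := by
      have h2 : f (z ^ 2) * (B (z ^ 2) / z) ^ 2 = 1 := by rw [div_pow, ← mul_div_assoc, hz2]; field_simp
      have h3 : f (y ^ 2) * (B (y ^ 2) / y) ^ 2 = 1 := by rw [div_pow, ← mul_div_assoc, hy2]; field_simp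
      rw [← hzy] at h3
      exact mul_right_cancel₀ (pow_ne_zero 2 (div_ne_zero hz1 hz0)) (h2.trans h3.symm)
    have h2 := hf.injOn (hsqmem z hz.2) (hsqmem y hy.2) h1
    rw [h2] at hzy
    rw [div_eq_div_iff hz0 hy0] at hzy
    exact (mul_left_cancel₀ hy1 hzy).symm) (2 * n)
  refine le_trans (le_of_eq ?_) harea
  rw [hcoef]
  clear harea
  beta_reduce
  induction n with
  | zero => simp
  | succ n ih =>
    rw [Finset.sum_range_succ, ih, show 2 * (n + 1) = 2 * n + 1 + 1 by ring,
      Finset.sum_range_succ, Finset.sum_range_succ]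
    rw [if_pos (by omega : 2 ∣ 2 * n + 2), if_neg (by omega : ¬ 2 ∣ 2 * n + 1 + 2),
      show (2 * n + 2) / 2 = n + 1 by omega]
    push_cast
    simp

theorem antidiagonal_two : Finset.HasAntidiagonal.antidiagonal 2 =
    ({(0, 2), (1, 1), (2, 0)} : Finset (ℕ × ℕ)) := rfl

theorem antidiagonal_one : Finset.HasAntidiagonal.antidiagonal 1 =
    ({(0, 1), (1, 0)} : Finset (ℕ × ℕ)) := rfl

theorem IsSchlicht.taylorCoeff_two_eq {f B : ℂ → ℂ} (hf : IsSchlicht f)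
    (hB : DifferentiableOn ℂ B (ball 0 1)) (hB0 : B 0 = 1)
    (hfB : ∀ z ∈ ball (0 : ℂ) 1, f z * B z ^ 2 = z) :
    taylorCoeff f 2 = -2 * taylorCoeff B 1 := by
  have h1 := congrFun (taylorCoeff_congr (f := fun z => f z * (B z * B z)) differentiableOn_id
    fun z hz => by simpa only [← pow_two, id] using hfB z hz) 2
  rw [taylorCoeff_mul hf.differentiableOn (hB.fun_mul hB), taylorCoeff_mul hB hB] at h1
  beta_reduce at h1
  rw [antidiagonal_two] at h1
  have h2 : taylorCoeff id 2 = 0 := by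
    rw [show (id : ℂ → ℂ) = fun z => z from rfl, taylorCoeff_id]; simp
  simp [antidiagonal_one, taylorCoeff_zero, taylorCoeff_one f, hf.map_zero, hf.deriv_zero, hB0, h2]
    at h1
  linear_combination h1

theorem IsSchlicht.norm_taylorCoeff_two_le {f : ℂ → ℂ} (hf : IsSchlicht f) :
    ‖taylorCoeff f 2‖ ≤ 2 := by
  obtain ⟨B, hB, hB0, hfB, hsum⟩ := hf.exists_inv_sqrt
  rw [hf.taylorCoeff_two_eq hB hB0 fun z hz => (hfB z hz).2, norm_mul]
  have := hsum 1
  simp only [Finset.sum_range_one] at this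
  norm_num at this ⊢
  linarith

theorem IsSchlicht.one_le_norm_mul {f : ℂ → ℂ} (hf : IsSchlicht f) {w : ℂ}
    (hw : w ∉ f '' ball 0 1) : 1 ≤ ‖w‖ * (2 + ‖taylorCoeff f 2‖) := by
  have h0mem : (0 : ℂ) ∈ ball (0 : ℂ) 1 := mem_ball_self one_pos
  have hw0 : w ≠ 0 := fun h => hw ⟨0, h0mem, by rw [hf.map_zero, h]⟩
  have hne : ∀ z ∈ ball (0 : ℂ) 1, w - f z ≠ 0 := fun z hz h =>
    hw ⟨z, hz, (sub_eq_zero.1 h).symm⟩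
  have hd : DifferentiableOn ℂ (fun z => w - f z) (ball 0 1) := hf.differentiableOn.const_sub w
  set F : ℂ → ℂ := fun z => w * f z / (w - f z) with hF
  have hFd : DifferentiableOn ℂ F (ball 0 1) :=
    (hf.differentiableOn.const_mul w).fun_div hd hne
  have hFs : IsSchlicht F := by
    refine ⟨hFd, fun z hz y hy h => hf.injOn hz hy ?_, by simp [hF, hf.map_zero], ?_⟩
    · simp only [hF] at h
      rw [div_eq_div_iff (hne z hz) (hne y hy)] at h
      refine mul_left_cancel₀ (pow_ne_zero 2 hw0) ?_
      linear_combination h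
    · have hfd := (hf.differentiableOn.differentiableAt (isOpen_ball.mem_nhds h0mem)).hasDerivAt
      have := (hfd.const_mul w).fun_div (hfd.const_sub w) (hne 0 h0mem)
      rw [hF, this.deriv, hf.deriv_zero, hf.map_zero]
      field_simp
      ring
  have hmul := congrFun (taylorCoeff_congr (f := fun z => F z * (w - f z))
    (g := fun z => w * f z) (hf.differentiableOn.const_mul w) fun z hz => by
      have := hne z hz
      simp only [hF]
      field_simp) 2
  have hsub : ∀ n, taylorCoeff (fun z => w - f z) n =
      (if n = 0 then w else 0) - taylorCoeff f n := congrFun <|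
    taylorCoeff_eq_of_hasSum one_pos fun z hz => by
      have h1 := taylorCoeff_const w ▸ hasSum_taylorCoeff (f := fun _ => w) (by fun_prop) hz
      simpa [sub_mul] using h1.sub (hasSum_taylorCoeff hf.differentiableOn hz)
  rw [taylorCoeff_mul hFd hd, taylorCoeff_mul (f := fun _ => w) (by fun_prop) hf.differentiableOn,
    taylorCoeff_const] at hmul
  beta_reduce at hmul
  rw [antidiagonal_two] at hmul
  simp [hsub, taylorCoeff_zero, taylorCoeff_one, hf.map_zero, hf.deriv_zero, hFs.map_zero,
    hFs.deriv_zero] at hmul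
  have h1 := hFs.norm_taylorCoeff_two_le
  have h2 : w * taylorCoeff F 2 - w * taylorCoeff f 2 = 1 := by linear_combination hmul
  have h3 : ‖w * taylorCoeff F 2 - w * taylorCoeff f 2‖ = 1 := by rw [h2, norm_one]
  have h4 := norm_sub_le (w * taylorCoeff F 2) (w * taylorCoeff f 2)
  rw [norm_mul, norm_mul, h3] at h4
  nlinarith [norm_nonneg w]

theorem ofReal_mem_ball {t : ℝ} (h0 : 0 ≤ t) (h1 : t < 1) : (t : ℂ) ∈ ball (0 : ℂ) 1 := by
  rwa [mem_ball_zero_iff, Complex.norm_real, Real.norm_of_nonneg h0]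

theorem one_add_mul_ne_zero {t : ℝ} (h0 : 0 ≤ t) (h1 : t < 1) {z : ℂ} (hz : z ∈ ball (0 : ℂ) 1) :
    1 + t * z ≠ 0 := fun h => by
  have h2 : (t : ℂ) * z = -1 := by linear_combination h
  have h3 : t * ‖z‖ = 1 := by
    have := congrArg norm h2
    rwa [norm_mul, Complex.norm_real, Real.norm_of_nonneg h0, norm_neg, norm_one] at this
  have h4 : ‖z‖ < 1 := by simpa using hz
  nlinarith [norm_nonneg z]

theorem mobius_mem_ball {t : ℝ} (h0 : 0 ≤ t) (h1 : t < 1) {z : ℂ} (hz : z ∈ ball (0 : ℂ) 1) :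
    (z + t) / (1 + t * z) ∈ ball (0 : ℂ) 1 := by
  have h2 := one_add_mul_ne_zero h0 h1 hz
  have h4 : ‖z‖ < 1 := by simpa using hz
  rw [mem_ball_zero_iff, norm_div, div_lt_one (norm_pos_iff.2 h2)]
  refine lt_of_pow_lt_pow_left₀ 2 (norm_nonneg _) ?_
  have h5 : ‖z‖ ^ 2 < 1 := by nlinarith [norm_nonneg z]
  simp only [← Complex.normSq_eq_norm_sq, Complex.normSq_apply] at h5 ⊢
  simp
  nlinarith [mul_pos (sub_pos.2 h5) (show 0 < 1 - t ^ 2 by nlinarith)]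

theorem hasDerivAt_mobius {t : ℝ} (h0 : 0 ≤ t) (h1 : t < 1) {z : ℂ} (hz : z ∈ ball (0 : ℂ) 1) :
    HasDerivAt (fun z : ℂ => (z + t) / (1 + t * z)) ((1 - t ^ 2) / (1 + t * z) ^ 2) z := by
  have h2 := one_add_mul_ne_zero h0 h1 hz
  convert! ((hasDerivAt_id z).add_const (t : ℂ)).fun_div
    (((hasDerivAt_id z).const_mul (t : ℂ)).const_add 1) h2 using 1
  simp only [id]
  ring

theorem IsSchlicht.deriv_ne_zero {f : ℂ → ℂ} (hf : IsSchlicht f) {z : ℂ}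
    (hz : z ∈ ball (0 : ℂ) 1) : deriv f z ≠ 0 :=
  deriv_ne_zero_of_injOn (hf.differentiableOn.analyticAt (isOpen_ball.mem_nhds hz))
    (isOpen_ball.mem_nhds hz) hf.injOn

theorem IsSchlicht.hasDerivAt {f : ℂ → ℂ} (hf : IsSchlicht f) {z : ℂ}
    (hz : z ∈ ball (0 : ℂ) 1) : HasDerivAt f (deriv f z) z :=
  (hf.differentiableOn.differentiableAt (isOpen_ball.mem_nhds hz)).hasDerivAt

theorem IsSchlicht.hasDerivAt_deriv {f : ℂ → ℂ} (hf : IsSchlicht f) {z : ℂ}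
    (hz : z ∈ ball (0 : ℂ) 1) : HasDerivAt (deriv f) (deriv (deriv f) z) z :=
  ((hf.differentiableOn.deriv isOpen_ball).differentiableAt (isOpen_ball.mem_nhds hz)).hasDerivAt

theorem IsSchlicht.norm_second_deriv_le {f : ℂ → ℂ} (hf : IsSchlicht f) {t : ℝ}
    (h0 : 0 ≤ t) (h1 : t < 1) :
    ‖(1 - t ^ 2) * (deriv (deriv f) t / deriv f t) - 2 * t‖ ≤ 4 := by
  have ht := ofReal_mem_ball h0 h1
  have h0mem : (0 : ℂ) ∈ ball (0 : ℂ) 1 := mem_ball_self one_pos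
  have hd := hf.deriv_ne_zero ht
  have ht2 : (1 - t ^ 2 : ℂ) ≠ 0 := by
    norm_cast
    nlinarith
  set φ : ℂ → ℂ := fun z => (z + t) / (1 + t * z) with hφ
  have hφ0 : φ 0 = t := by simp [hφ]
  set K : ℂ → ℂ := fun z => (f (φ z) - f t) / ((1 - t ^ 2) * deriv f t) with hK
  have hKd : ∀ z ∈ ball (0 : ℂ) 1,
      HasDerivAt K (deriv f (φ z) / ((1 + t * z) ^ 2 * deriv f t)) z := fun z hz => by
    have h2 := one_add_mul_ne_zero h0 h1 hz
    have := (((hf.hasDerivAt (mobius_mem_ball h0 h1 hz)).comp z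
      (hasDerivAt_mobius h0 h1 hz)).sub_const (f t)).div_const ((1 - t ^ 2) * deriv f t)
    convert! this using 1
    field_simp
    rfl
  have hKs : IsSchlicht K := by
    refine ⟨fun z hz => (hKd z hz).differentiableAt.differentiableWithinAt,
      fun z hz y hy h => ?_, by simp [hK, hφ0], ?_⟩
    · simp only [hK] at h
      rw [div_left_inj' (mul_ne_zero ht2 hd), sub_left_inj] at h
      have h3 := hf.injOn (mobius_mem_ball h0 h1 hz) (mobius_mem_ball h0 h1 hy) h
      rw [div_eq_div_iff (one_add_mul_ne_zero h0 h1 hz) (one_add_mul_ne_zero h0 h1 hy)] at h3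
      refine mul_left_cancel₀ ht2 ?_
      linear_combination h3
    · rw [(hKd 0 h0mem).deriv, hφ0]
      simp [hd]
  have h2 : deriv (deriv K) 0 = (1 - t ^ 2) * (deriv (deriv f) t / deriv f t) - 2 * t := by
    have he : deriv K =ᶠ[𝓝 0] fun z => deriv f (φ z) / ((1 + t * z) ^ 2 * deriv f t) := by
      filter_upwards [isOpen_ball.mem_nhds h0mem] with z hz using (hKd z hz).deriv
    rw [he.deriv_eq]
    have hn := (hf.hasDerivAt_deriv (mobius_mem_ball h0 h1 h0mem)).comp 0
      (hasDerivAt_mobius h0 h1 h0mem)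
    have hm := ((((hasDerivAt_id (0 : ℂ)).const_mul (t : ℂ)).const_add 1).fun_pow 2).mul_const
      (deriv f t)
    have := hn.fun_div hm (by simp [hd])
    refine this.deriv.trans ?_
    simp
    field_simp
  have h3 := hKs.norm_taylorCoeff_two_le
  rw [taylorCoeff, iteratedDeriv_succ, iteratedDeriv_one, h2, norm_div] at h3
  norm_num at h3
  linarith

theorem IsSchlicht.inner_deriv_le {f : ℂ → ℂ} (hf : IsSchlicht f) {t : ℝ}
    (h0 : 0 ≤ t) (h1 : t < 1) :
    (1 - t ^ 2) * inner ℝ (deriv f t) (deriv (deriv f) t) ≤ (4 + 2 * t) * ‖deriv f t‖ ^ 2 := by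
  have hd := hf.deriv_ne_zero (ofReal_mem_ball h0 h1)
  have h2 := (Complex.re_le_norm _).trans (hf.norm_second_deriv_le h0 h1)
  have h3 : inner ℝ (deriv f t) (deriv (deriv f) t) =
      (deriv (deriv f) t / deriv f t).re * ‖deriv f t‖ ^ 2 := by
    rw [← Complex.normSq_eq_norm_sq, Complex.inner, Complex.div_re]
    have := (Complex.normSq_pos.2 hd).ne'
    field_simp
    simp
  have h4 : ((1 - t ^ 2) * (deriv (deriv f) t / deriv f t) - 2 * t : ℂ).re =
      (1 - t ^ 2) * (deriv (deriv f) t / deriv f t).re - 2 * t := by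
    have : ((1 - t ^ 2) * (deriv (deriv f) t / deriv f t) - 2 * t : ℂ) =
      ((1 - t ^ 2 : ℝ) : ℂ) * (deriv (deriv f) t / deriv f t) - ((2 * t : ℝ) : ℂ) := by
        push_cast; ring
    rw [this, Complex.sub_re, Complex.re_ofReal_mul, Complex.ofReal_re]
  rw [h4] at h2
  rw [h3, ← mul_assoc]
  exact mul_le_mul_of_nonneg_right (by linarith) (sq_nonneg _)

theorem IsSchlicht.norm_deriv_le {f : ℂ → ℂ} (hf : IsSchlicht f) {t : ℝ}
    (h0 : 0 ≤ t) (h1 : t < 1) : ‖deriv f t‖ ≤ (1 + t) / (1 - t) ^ 3 := by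
  set h : ℝ → ℝ := fun s => ‖deriv f s‖ ^ 2 * ((1 - s) ^ 3 / (1 + s)) ^ 2 with hh
  have hder : ∀ s : ℝ, 0 ≤ s → s < 1 → HasDerivAt h
      (2 * inner ℝ (deriv f s) (deriv (deriv f) s) * ((1 - s) ^ 3 / (1 + s)) ^ 2 +
        ‖deriv f s‖ ^ 2 * (2 * ((1 - s) ^ 3 / (1 + s)) *
          (-(2 * (1 - s) ^ 2 * (2 + s)) / (1 + s) ^ 2))) s := fun s hs0 hs1 => by
    have e1 := ((hf.hasDerivAt_deriv (ofReal_mem_ball hs0 hs1)).comp_ofReal).norm_sq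
    have e2 := ((((hasDerivAt_id s).const_sub 1).fun_pow 3).fun_div
      ((hasDerivAt_id s).const_add 1) (by simp only [id]; linarith)).fun_pow 2
    convert! e1.mul e2 using 1
    simp only [id]
    push_cast
    ring
  have hanti : AntitoneOn h (Set.Icc 0 t) := by
    refine antitoneOn_of_deriv_nonpos (convex_Icc 0 t)
      (fun s hs => (hder s hs.1 (hs.2.trans_lt h1)).continuousAt.continuousWithinAt) ?_ ?_
    · rw [interior_Icc]
      exact fun s hs => (hder s hs.1.le (hs.2.trans h1)).differentiableAt.differentiableWithinAt
    · rw [interior_Icc]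
      intro s hs
      have hs1 := hs.2.trans h1
      rw [(hder s hs.1.le hs1).deriv]
      have e := hf.inner_deriv_le hs.1.le hs1
      have hp : 0 < 1 + s := by linarith [hs.1]
      have e2 : 0 ≤ 2 * (1 - s) ^ 5 / (1 + s) ^ 3 := by
        have : 0 ≤ 1 - s := by linarith
        positivity
      have := mul_le_mul_of_nonneg_left e e2
      rw [← sub_nonneg] at this ⊢
      refine this.trans_eq ?_
      field_simp
      ring
  have h2 := hanti (Set.left_mem_Icc.2 h0) (Set.right_mem_Icc.2 h0) h0
  simp only [hh] at h2
  rw [← mul_pow] at h2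
  simp [hf.deriv_zero] at h2
  have hp : 0 < 1 + t := by linarith
  have hm : 0 < 1 - t := by linarith
  rw [abs_of_pos (by positivity : 0 < (1 - t) ^ 3 / (1 + t)), ← mul_div_assoc,
    div_le_one hp] at h2
  rwa [le_div_iff₀ (by positivity)]

theorem IsSchlicht.norm_ofReal_le {f : ℂ → ℂ} (hf : IsSchlicht f) {r : ℝ}
    (h0 : 0 ≤ r) (h1 : r < 1) : ‖f r‖ ≤ r / (1 - r) ^ 2 := by
  have hB : ∀ s : ℝ, s < 1 → HasDerivAt (fun s : ℝ => s / (1 - s) ^ 2) ((1 + s) / (1 - s) ^ 3) s :=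
    fun s hs => by
      have hs' : 1 - s ≠ 0 := by linarith
      convert! (hasDerivAt_id s).fun_div (((hasDerivAt_id s).const_sub 1).fun_pow 2)
        (pow_ne_zero 2 hs') using 1
      simp only [id]
      field_simp
      norm_num
      ring
  refine image_norm_le_of_norm_deriv_right_le_deriv_boundary' (f := fun s : ℝ => f s)
    (f' := fun s : ℝ => deriv f s) (a := 0) (b := r)
    (fun s hs => ?_) (fun s hs => ?_) (B := fun s : ℝ => s / (1 - s) ^ 2) (by simp [hf.map_zero])
    (fun s hs => (hB s (hs.2.trans_lt h1)).continuousAt.continuousWithinAt)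
    (fun s hs => (hB s (hs.2.trans h1)).hasDerivWithinAt)
    (fun s hs => hf.norm_deriv_le hs.1 (hs.2.trans h1)) (Set.right_mem_Icc.2 h0)
  · exact (hf.hasDerivAt (ofReal_mem_ball hs.1
      (hs.2.trans_lt h1))).comp_ofReal.continuousAt.continuousWithinAt
  · exact (hf.hasDerivAt (ofReal_mem_ball hs.1 (hs.2.trans h1))).comp_ofReal.hasDerivWithinAt

theorem taylorCoeff_sub {f g : ℂ → ℂ} (hf : DifferentiableOn ℂ f (ball 0 1))
    (hg : DifferentiableOn ℂ g (ball 0 1)) :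
    taylorCoeff (fun z => f z - g z) = fun n => taylorCoeff f n - taylorCoeff g n := by
  refine taylorCoeff_eq_of_hasSum one_pos fun z hz => ?_
  simpa [sub_mul] using (hasSum_taylorCoeff hf hz).sub (hasSum_taylorCoeff hg hz)

theorem majorant_congr {f g : ℂ → ℂ} (hg : DifferentiableOn ℂ g (ball 0 1))
    (h : Set.EqOn f g (ball 0 1)) (r : ℝ) : majorant f r = majorant g r := by
  unfold majorant
  rw [taylorCoeff_congr hg h]

theorem differentiableOn_inv_one_sub : DifferentiableOn ℂ (fun z : ℂ => (1 - z)⁻¹) (ball 0 1) :=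
  DifferentiableOn.fun_inv (by fun_prop) fun z hz h => by
    rw [← sub_eq_zero.1 h] at hz
    simp at hz

theorem taylorCoeff_inv_one_sub (n : ℕ) : taylorCoeff (fun z : ℂ => (1 - z)⁻¹) n = 1 :=
  congrFun (taylorCoeff_eq_of_hasSum (a := fun _ => 1) one_pos fun z hz => by
    simpa using hasSum_geometric_of_norm_lt_one hz) n

theorem majorant_inv_one_sub {r : ℝ} (h0 : 0 ≤ r) (h1 : r < 1) :
    majorant (fun z : ℂ => (1 - z)⁻¹) r = (1 - r)⁻¹ := by
  unfold majorant
  simp [taylorCoeff_inv_one_sub, tsum_geometric_of_lt_one h0 h1]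

theorem majorant_le_of_sum_sq_le {f : ℂ → ℂ} (hf : DifferentiableOn ℂ f (ball 0 1)) {r σ y : ℝ}
    (h0 : 0 ≤ r) (h1 : r < 1) (hσ : 0 ≤ σ) (hy : 0 ≤ y)
    (hsum : ∀ n, ∑ m ∈ Finset.range n, ‖taylorCoeff f (m + 2)‖ ^ 2 ≤ σ ^ 2)
    (hr : r ^ 4 ≤ y ^ 2 * (1 - r ^ 2)) :
    majorant f r ≤ ‖taylorCoeff f 0‖ + ‖taylorCoeff f 1‖ * r + σ * y := by
  have hs := summable_majorant hf h0 h1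
  have hr2 : r ^ 2 < 1 := pow_lt_one₀ h0 h1 two_ne_zero
  unfold majorant
  rw [← hs.sum_add_tsum_nat_add 2, Finset.sum_range_succ, Finset.sum_range_one]
  simp only [pow_zero, mul_one, pow_one]
  gcongr
  refine Real.tsum_le_of_sum_range_le (fun n => by positivity) fun n => ?_
  refine le_of_sq_le_sq ?_ (by positivity)
  calc (∑ m ∈ Finset.range n, ‖taylorCoeff f (m + 2)‖ * r ^ (m + 2)) ^ 2
      ≤ (∑ m ∈ Finset.range n, ‖taylorCoeff f (m + 2)‖ ^ 2) *
        ∑ m ∈ Finset.range n, (r ^ (m + 2)) ^ 2 := Finset.sum_mul_sq_le_sq_mul_sq _ _ _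
    _ ≤ σ ^ 2 * y ^ 2 := by
      refine mul_le_mul (hsum n) ?_ (Finset.sum_nonneg fun _ _ => by positivity) (sq_nonneg σ)
      have h2 : ∑ m ∈ Finset.range n, (r ^ (m + 2)) ^ 2 =
          r ^ 4 * ∑ m ∈ Finset.range n, (r ^ 2) ^ m := by
        rw [Finset.mul_sum]
        exact Finset.sum_congr rfl fun m _ => by ring
      have h3 : ∑ m ∈ Finset.range n, (r ^ 2) ^ m ≤ (1 - r ^ 2)⁻¹ :=
        (tsum_geometric_of_lt_one (sq_nonneg r) hr2) ▸
          (summable_geometric_of_lt_one (sq_nonneg r) hr2).sum_le_tsum _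
            fun _ _ => by positivity
      rw [h2]
      calc _ ≤ y ^ 2 * (1 - r ^ 2) * (1 - r ^ 2)⁻¹ :=
            mul_le_mul hr h3 (Finset.sum_nonneg fun _ _ => by positivity)
              (mul_nonneg (sq_nonneg y) (by linarith))
        _ = y ^ 2 := by rw [mul_inv_cancel_right₀ (by linarith)]
    _ = (σ * y) ^ 2 := by ring

theorem norm_le_re_add (a : ℂ) : ‖a‖ ≤ a.re + ‖a - 1‖ ^ 2 / 2 := by
  have h1 : ‖a - 1‖ ^ 2 = ‖a‖ ^ 2 - 2 * a.re + 1 := by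
    simp only [← Complex.normSq_eq_norm_sq, Complex.normSq_apply, Complex.sub_re, Complex.sub_im,
      Complex.one_re, Complex.one_im]
    ring
  nlinarith [sq_nonneg (‖a‖ - 1)]

theorem tsum_sq_le_sq_tsum {p : ℕ → ℝ} (hp : ∀ n, 0 ≤ p n) (hs : Summable p) :
    Summable (fun n => p n ^ 2) ∧ ∑' n, p n ^ 2 ≤ (∑' n, p n) ^ 2 := by
  have h : ∀ n, p n ^ 2 ≤ (∑' n, p n) * p n := fun n => by
    rw [pow_two]
    exact mul_le_mul_of_nonneg_right (hs.le_tsum n fun j _ => hp j) (hp n)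
  have h2 : Summable fun n => p n ^ 2 :=
    Summable.of_nonneg_of_le (fun _ => sq_nonneg _) h (hs.mul_left _)
  refine ⟨h2, (h2.tsum_le_tsum h (hs.mul_left _)).trans_eq ?_⟩
  rw [tsum_mul_left, pow_two]

theorem majorant_sq_le_norm_add {C : ℂ → ℂ} (hC : DifferentiableOn ℂ C (ball 0 1)) {ρ : ℝ}
    (h0 : 0 ≤ ρ) (h1 : ρ < 1) :
    majorant C (ρ ^ 2) ≤
      ‖C ((ρ ^ 2 : ℝ) : ℂ)‖ + majorant (fun z => C z - (1 - z)⁻¹) ρ ^ 2 / 2 := by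
  have hr1 : ρ ^ 2 < 1 := pow_lt_one₀ h0 h1 two_ne_zero
  have hE := summable_majorant (hC.fun_sub differentiableOn_inv_one_sub) h0 h1
  obtain ⟨hE1, hE2⟩ := tsum_sq_le_sq_tsum (fun n => by positivity) hE
  have hre : HasSum (fun n => (taylorCoeff C n).re * (ρ ^ 2) ^ n) (C ((ρ ^ 2 : ℝ) : ℂ)).re := by
    have := Complex.hasSum_re (hasSum_taylorCoeff hC (z := ((ρ ^ 2 : ℝ) : ℂ))
      (by rwa [Complex.norm_real, Real.norm_of_nonneg (sq_nonneg ρ)]))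
    simpa only [← Complex.ofReal_pow, Complex.re_mul_ofReal] using this
  have hle : ∀ n, ‖taylorCoeff C n‖ * (ρ ^ 2) ^ n ≤ (taylorCoeff C n).re * (ρ ^ 2) ^ n +
      (‖taylorCoeff (fun z => C z - (1 - z)⁻¹) n‖ * ρ ^ n) ^ 2 / 2 := fun n => by
    rw [taylorCoeff_sub hC differentiableOn_inv_one_sub]
    beta_reduce
    rw [taylorCoeff_inv_one_sub]
    refine (mul_le_mul_of_nonneg_right (norm_le_re_add _) (by positivity)).trans_eq ?_
    ring
  calc majorant C (ρ ^ 2) ≤ ∑' n, ((taylorCoeff C n).re * (ρ ^ 2) ^ n +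
        (‖taylorCoeff (fun z => C z - (1 - z)⁻¹) n‖ * ρ ^ n) ^ 2 / 2) :=
        (summable_majorant hC (sq_nonneg ρ) hr1).tsum_le_tsum hle
          (hre.summable.add (hE1.div_const 2))
    _ = (C ((ρ ^ 2 : ℝ) : ℂ)).re +
        (∑' n, (‖taylorCoeff (fun z => C z - (1 - z)⁻¹) n‖ * ρ ^ n) ^ 2) / 2 := by
      rw [hre.summable.tsum_add (hE1.div_const 2), hre.tsum_eq, tsum_div_const]
    _ ≤ _ := by
      gcongr
      · exact Complex.re_le_norm _
      · exact hE2

/-- If `C = 1 / B` is close to `1 / (1 - z)` then its majorant is controlled by that of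
`1 - z - B`. -/
theorem majorant_sub_inv_one_sub_le {B C : ℂ → ℂ} (hB : DifferentiableOn ℂ B (ball 0 1))
    (hC : DifferentiableOn ℂ C (ball 0 1)) (hBC : ∀ z ∈ ball (0 : ℂ) 1, B z * C z = 1) {r : ℝ}
    (h0 : 0 ≤ r) (h1 : r < 1) :
    majorant (fun z => C z - (1 - z)⁻¹) r ≤
      ((1 - r)⁻¹ + majorant (fun z => C z - (1 - z)⁻¹) r) *
        ((1 - r)⁻¹ * majorant (fun z => 1 - z - B z) r) := by
  have hK := differentiableOn_inv_one_sub
  have hD : DifferentiableOn ℂ (fun z => 1 - z - B z) (ball 0 1) := by fun_prop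
  have hE : DifferentiableOn ℂ (fun z => C z - (1 - z)⁻¹) (ball 0 1) := hC.fun_sub hK
  have h2 : majorant C r ≤ (1 - r)⁻¹ + majorant (fun z => C z - (1 - z)⁻¹) r := by
    rw [← majorant_inv_one_sub h0 h1]
    refine le_trans (le_of_eq ?_) (majorant_add_le hK hE h0 h1)
    simp
  have h3 : majorant (fun z => C z - (1 - z)⁻¹) r =
      majorant (fun z => C z * ((1 - z)⁻¹ * (1 - z - B z))) r :=
    majorant_congr (hC.fun_mul (hK.fun_mul hD)) (fun z hz => by
      have hz1 : 1 - z ≠ 0 := fun h => by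
        rw [← sub_eq_zero.1 h] at hz
        simp at hz
      have := hBC z hz
      beta_reduce
      field_simp
      linear_combination this) r
  calc _ = _ := h3
    _ ≤ majorant C r * (majorant (fun z : ℂ => (1 - z)⁻¹) r * majorant (fun z => 1 - z - B z) r) :=
      (majorant_mul_le hC (hK.fun_mul hD) h0 h1).trans
        (mul_le_mul_of_nonneg_left (majorant_mul_le hK hD h0 h1) (majorant_nonneg _ h0))
    _ ≤ _ := by
      rw [majorant_inv_one_sub h0 h1]
      refine mul_le_mul_of_nonneg_right h2 (mul_nonneg ?_ (majorant_nonneg _ h0))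
      exact inv_nonneg.2 (by linarith)

theorem majorant_inv_le {B C : ℂ → ℂ} (hB : DifferentiableOn ℂ B (ball 0 1))
    (hC : DifferentiableOn ℂ C (ball 0 1)) (hBC : ∀ z ∈ ball (0 : ℂ) 1, B z * C z = 1) {r : ℝ}
    (h0 : 0 ≤ r) (h1 : r < 1) :
    majorant C r ≤ 1 + majorant (fun z => 1 - B z) r * majorant C r := by
  have hD : DifferentiableOn ℂ (fun z => 1 - B z) (ball 0 1) := by fun_prop
  have h3 : majorant C r = majorant (fun z => 1 + (1 - B z) * C z) r :=
    majorant_congr (by fun_prop) (fun z hz => by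
      linear_combination hBC z hz) r
  calc majorant C r = _ := h3
    _ ≤ majorant (fun _ => 1) r + majorant (fun z => (1 - B z) * C z) r :=
      majorant_add_le (f := fun _ => 1) (by fun_prop) (hD.fun_mul hC) h0 h1
    _ ≤ _ := by
      rw [majorant_const, norm_one]
      gcongr
      exact majorant_mul_le hD hC h0 h1

theorem sq_le_of_far {ρ c σ m M : ℝ} (hρ0 : 0 < ρ) (hρ : ρ ^ 2 + 2 * ρ = 1) (hc0 : 0 ≤ c)
    (hσ : σ ^ 2 = 1 - c ^ 2) (hσ0 : 0 ≤ σ) (hc : c ≤ 0.9955) (hM0 : 0 ≤ M)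
    (hm : m ≤ c * ρ ^ 2 + σ * 0.0173) (hM : M ≤ 1 + m * M) :
    ρ ^ 2 * M ^ 2 ≤ 1 / (2 + 2 * c) := by
  have h1 : 0.4142 < ρ := by nlinarith
  have h2 : ρ < 0.41422 := by nlinarith
  have h3 : ρ ^ 2 = 1 - 2 * ρ := by linarith
  have hσδ : 0.0457 * σ ≤ 1 - c := by
    refine le_of_sq_le_sq ?_ (by linarith)
    nlinarith
  have hQ : 2 * ρ - 0.207 * (1 - c) ≤ 1 - m := by nlinarith
  have hQ0 : 0 < 2 * ρ - 0.207 * (1 - c) := by nlinarith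
  have hMQ : M * (2 * ρ - 0.207 * (1 - c)) ≤ 1 := by nlinarith
  have hMQ2 : (M * (2 * ρ - 0.207 * (1 - c))) ^ 2 ≤ 1 := pow_le_one₀ (by positivity) hMQ
  have hfin : 2 * ρ ^ 2 * (1 + c) ≤ (2 * ρ - 0.207 * (1 - c)) ^ 2 := by
    nlinarith [mul_nonneg (mul_nonneg hρ0.le (by linarith : 0 ≤ ρ - 0.414))
      (by linarith : 0 ≤ 1 - c), sq_nonneg (1 - c)]
  rw [le_div_iff₀ (by positivity)]
  calc ρ ^ 2 * M ^ 2 * (2 + 2 * c) = M ^ 2 * (2 * ρ ^ 2 * (1 + c)) := by ring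
    _ ≤ M ^ 2 * (2 * ρ - 0.207 * (1 - c)) ^ 2 := by gcongr
    _ ≤ 1 := by rwa [← mul_pow]

theorem sq_le_of_near {ρ c σ m M N : ℝ} (hρ0 : 0 < ρ) (hρ : ρ ^ 2 + 2 * ρ = 1)
    (hσ : σ ^ 2 = 1 - c ^ 2) (hσ0 : 0 ≤ σ) (hc : 0.9955 ≤ c) (hc1 : c ≤ 1) (hN0 : 0 ≤ N)
    (hM0 : 0 ≤ M)
    (hm : m ≤ (1 - c) * ρ + σ * 0.109) (hN : N ≤ ((1 - ρ)⁻¹ + N) * ((1 - ρ)⁻¹ * m))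
    (hM : M ≤ (1 - ρ ^ 2)⁻¹ + N ^ 2 / 2) :
    ρ ^ 2 * M ^ 2 ≤ 1 / (2 + 2 * c) := by
  have h1 : 0.4142 < ρ := by nlinarith
  have h2 : ρ < 0.41422 := by nlinarith
  have h3 : ρ ^ 2 = 1 - 2 * ρ := by linarith
  have hσδ : σ ^ 2 ≤ 2 * (1 - c) := by nlinarith
  have hσ1 : σ ≤ 0.095 := by nlinarith
  have hδσ : 1 - c ≤ 0.0476 * σ := by
    refine le_of_sq_le_sq ?_ (by positivity)
    nlinarith
  have hm' : m ≤ 0.1288 * σ := by nlinarith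
  have hk0 : 0 < (1 - ρ)⁻¹ := inv_pos.2 (by linarith)
  have hk : (1 - ρ)⁻¹ ≤ 1.7072 := by
    rw [inv_le_comm₀ (by linarith) (by norm_num)]
    norm_num
    linarith
  have hkm : (1 - ρ)⁻¹ * m ≤ 0.22 * σ :=
    calc (1 - ρ)⁻¹ * m ≤ (1 - ρ)⁻¹ * (0.1288 * σ) := by gcongr
      _ ≤ 1.7072 * (0.1288 * σ) := by gcongr
      _ ≤ 0.22 * σ := by linarith
  have hN1 : N ≤ (1.7072 + N) * (0.22 * σ) := hN.trans <|
    (mul_le_mul_of_nonneg_left hkm (by positivity)).trans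
      (mul_le_mul_of_nonneg_right (by linarith) (by positivity))
  have hN2 : N ≤ 0.39 * σ := by nlinarith
  have hN3 : N ^ 2 ≤ 0.3042 * (1 - c) := by nlinarith
  have hk2 : ρ * (1 - ρ ^ 2)⁻¹ = 1 / 2 := by
    rw [h3]
    field_simp
    ring
  have hρM : ρ * M ≤ 1 / 2 + 0.0632 * (1 - c) := by
    have := mul_le_mul_of_nonneg_left hM hρ0.le
    rw [mul_add, hk2] at this
    nlinarith
  rw [le_div_iff₀ (by linarith), ← mul_pow]
  have h4 : (ρ * M) ^ 2 ≤ (1 / 2 + 0.0632 * (1 - c)) ^ 2 :=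
    pow_le_pow_left₀ (by positivity) hρM 2
  nlinarith [mul_le_mul_of_nonneg_right h4 (by linarith : 0 ≤ 2 + 2 * c), sq_nonneg (1 - c),
    mul_nonneg (sq_nonneg (1 - c)) (by linarith : 0 ≤ 1 - c)]

theorem IsSchlicht.majorant_le_of_taylorCoeff_two_eq {f : ℂ → ℂ} (hf : IsSchlicht f) {c : ℝ}
    (hc : 0 ≤ c) (h2 : taylorCoeff f 2 = 2 * c) {ρ : ℝ} (hρ0 : 0 < ρ) (hρ : ρ ^ 2 + 2 * ρ = 1) :
    majorant f (ρ ^ 2) ≤ 1 / (2 + 2 * c) := by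
  have hρ1 : ρ < 1 := by nlinarith
  have hr0 : 0 ≤ ρ ^ 2 := sq_nonneg ρ
  have hr1 : ρ ^ 2 < 1 := by linarith
  obtain ⟨B, hB, hB0, hfB, hsum⟩ := hf.exists_inv_sqrt
  have hB1 : taylorCoeff B 1 = -c := by
    have := hf.taylorCoeff_two_eq hB hB0 fun z hz => (hfB z hz).2
    rw [h2] at this
    linear_combination this / 2
  have hn1 : ‖taylorCoeff B 1‖ = c := by rw [hB1, norm_neg, Complex.norm_real, Real.norm_of_nonneg hc]
  have hc2 : c ^ 2 ≤ 1 := by simpa [hn1] using hsum 1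
  have hc1 : c ≤ 1 := by nlinarith
  set σ := √(1 - c ^ 2) with hσ
  have hσ0 : 0 ≤ σ := Real.sqrt_nonneg _
  have hσ2 : σ ^ 2 = 1 - c ^ 2 := Real.sq_sqrt (by linarith)
  have htail : ∀ n, ∑ m ∈ Finset.range n, ‖taylorCoeff B (m + 2)‖ ^ 2 ≤ (σ / √3) ^ 2 := fun n => by
    have h3 := hsum (n + 1)
    rw [Finset.sum_range_succ'] at h3
    simp only [zero_add, hn1] at h3
    rw [div_pow, hσ2, Real.sq_sqrt (by norm_num), le_div_iff₀ (by norm_num), Finset.sum_mul]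
    have h4 : ∑ m ∈ Finset.range n, ‖taylorCoeff B (m + 2)‖ ^ 2 * 3 ≤
        ∑ m ∈ Finset.range n, (2 * ((m + 1 : ℕ) : ℝ) + 1) * ‖taylorCoeff B (m + 1 + 1)‖ ^ 2 := by
      refine Finset.sum_le_sum fun m _ => ?_
      rw [mul_comm]
      gcongr
      push_cast
      linarith [(Nat.cast_nonneg m : (0 : ℝ) ≤ m)]
    push_cast at h3 h4
    norm_num only at h3
    linarith
  have hD : ∀ b : ℂ, DifferentiableOn ℂ (fun z => 1 - b * z - B z) (ball 0 1) := fun b => by fun_prop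
  have hDcoef : ∀ (b : ℂ) (n : ℕ), taylorCoeff (fun z => 1 - b * z - B z) n =
      (if n = 0 then 1 else 0) - b * (if n = 1 then 1 else 0) - taylorCoeff B n := fun b n => by
    refine congrFun (taylorCoeff_eq_of_hasSum (a := fun n => (if n = 0 then 1 else 0) -
      b * (if n = 1 then 1 else 0) - taylorCoeff B n) one_pos fun z hz => ?_) n
    have e1 := taylorCoeff_const 1 ▸ hasSum_taylorCoeff (f := fun _ => 1) (by fun_prop) hz
    have e2 := (taylorCoeff_id ▸ hasSum_taylorCoeff (f := fun z => z) (by fun_prop) hz).mul_left b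
    convert! (e1.sub e2).sub (hasSum_taylorCoeff hB hz) using 2 with m
    ring
  have hDle : ∀ b x y : ℝ, 0 ≤ x → x < 1 → 0 ≤ y → x ^ 4 ≤ 3 * y ^ 2 * (1 - x ^ 2) →
      majorant (fun z => 1 - b * z - B z) x ≤ |c - b| * x + σ * y := fun b x y hx0 hx1 hy hxy => by
    refine (majorant_le_of_sum_sq_le (hD b) hx0 hx1 (σ := σ / √3) (y := √3 * y) (by positivity)
      (by positivity) (fun n => ?_) ?_).trans_eq ?_
    · simpa [hDcoef] using htail n
    · rwa [mul_pow, Real.sq_sqrt (by norm_num)]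
    · have e : (0 - b * 1 - -c : ℂ) = ((c - b : ℝ) : ℂ) := by push_cast; ring
      have h3 : √3 ≠ 0 := by positivity
      simp only [hDcoef, taylorCoeff_zero, hB0, hB1, one_ne_zero, zero_ne_one, if_true, if_false, e,
        Complex.norm_real, Real.norm_eq_abs]
      field_simp
      simp
  set C : ℂ → ℂ := fun z => (B z)⁻¹ with hCdef
  have hC : DifferentiableOn ℂ C (ball 0 1) := hB.fun_inv fun z hz => (hfB z hz).1
  have hBC : ∀ z ∈ ball (0 : ℂ) 1, B z * C z = 1 := fun z hz => mul_inv_cancel₀ (hfB z hz).1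
  have hfC : ∀ z ∈ ball (0 : ℂ) 1, f z = z * (C z * C z) := fun z hz => by
    have h4 := hBC z hz
    linear_combination (C z * C z) * (hfB z hz).2 - f z * (1 + B z * C z) * h4
  have hM0 := majorant_nonneg C hr0
  have hfM : majorant f (ρ ^ 2) ≤ ρ ^ 2 * majorant C (ρ ^ 2) ^ 2 := by
    rw [majorant_congr (differentiableOn_id.fun_mul (hC.fun_mul hC)) hfC]
    refine (majorant_mul_le differentiableOn_id (hC.fun_mul hC) hr0 hr1).trans ?_
    rw [show (id : ℂ → ℂ) = fun z => z from rfl, majorant_id, pow_two (majorant C _)]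
    exact mul_le_mul_of_nonneg_left (majorant_mul_le hC hC hr0 hr1) hr0
  refine hfM.trans ?_
  rcases le_total c 0.9955 with hc3 | hc3
  · have := hDle 0 (ρ ^ 2) 0.0173 hr0 hr1 (by norm_num) (by
      have : ρ ^ 2 < 0.1716 := by nlinarith
      nlinarith [pow_le_pow_left₀ hr0 this.le 2, pow_le_pow_left₀ hr0 this.le 4])
    refine sq_le_of_far hρ0 hρ hc hσ2 hσ0 hc3 hM0 (m := majorant (fun z => 1 - B z) (ρ ^ 2)) ?_
      (majorant_inv_le hB hC hBC hr0 hr1)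
    simpa [abs_of_nonneg hc] using this
  · have hm := hDle 1 ρ 0.109 hρ0.le hρ1 (by norm_num) (by
      have h5 : ρ ^ 4 = (1 - 2 * ρ) ^ 2 := by rw [← hρ]; ring
      have h6 : ρ < 0.41422 := by nlinarith
      have h7 : 0.4142 < ρ := by nlinarith
      nlinarith)
    rw [abs_of_nonpos (by linarith), neg_sub] at hm
    refine sq_le_of_near hρ0 hρ hσ2 hσ0 hc3 hc1 (majorant_nonneg _ hρ0.le) hM0 hm
      (by simpa using majorant_sub_inv_one_sub_le hB hC hBC hρ0.le hρ1)
      ((majorant_sq_le_norm_add hC hρ0.le hρ1).trans (add_le_add_left ?_ _))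
    have h3 := hf.norm_ofReal_le hr0 hr1
    rw [hfC _ (ofReal_mem_ball hr0 hr1), norm_mul, norm_mul, Complex.norm_real,
      Real.norm_of_nonneg hr0, div_eq_mul_inv] at h3
    have h4 := le_of_mul_le_mul_left h3 (by positivity)
    refine le_of_sq_le_sq ?_ (inv_nonneg.2 (by linarith))
    rwa [pow_two, inv_pow]

theorem exists_norm_eq_one_mul_eq_norm (a : ℂ) : ∃ u : ℂ, ‖u‖ = 1 ∧ u * a = ‖a‖ := by
  rcases eq_or_ne a 0 with rfl | ha
  · exact ⟨1, by simp, by simp⟩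
  · have h : (‖a‖ : ℂ) ≠ 0 := by simpa using ha
    refine ⟨‖a‖ / a, ?_, div_mul_cancel₀ _ ha⟩
    rw [norm_div, Complex.norm_real, norm_norm, div_self (norm_ne_zero_iff.2 ha)]

theorem IsSchlicht.majorant_le {f : ℂ → ℂ} (hf : IsSchlicht f) {ρ : ℝ} (hρ0 : 0 < ρ)
    (hρ : ρ ^ 2 + 2 * ρ = 1) : majorant f (ρ ^ 2) ≤ 1 / (2 + ‖taylorCoeff f 2‖) := by
  obtain ⟨u, hu, hua⟩ := exists_norm_eq_one_mul_eq_norm (taylorCoeff f 2)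
  have hu0 : u ≠ 0 := norm_ne_zero_iff.1 (by rw [hu]; exact one_ne_zero)
  have h0mem : (0 : ℂ) ∈ ball (0 : ℂ) 1 := mem_ball_self one_pos
  have hmem : ∀ z ∈ ball (0 : ℂ) 1, u * z ∈ ball (0 : ℂ) 1 := fun z hz => by
    simpa [hu] using hz
  set F : ℂ → ℂ := fun z => u⁻¹ * f (u * z) with hF
  have hd : DifferentiableOn ℂ F (ball 0 1) :=
    (hf.differentiableOn.fun_comp (by fun_prop) hmem).const_mul u⁻¹
  have hcoef : ∀ n, taylorCoeff F n = u⁻¹ * u ^ n * taylorCoeff f n :=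
    congrFun <| taylorCoeff_eq_of_hasSum one_pos fun z hz => by
      convert! (hasSum_taylorCoeff hf.differentiableOn (z := u * z)
        (by simpa using hmem z (by simpa using hz))).mul_left u⁻¹ using 2 with n
      ring
  have hFs : IsSchlicht F := by
    refine ⟨hd, fun z hz y hy h => ?_, by simp [hF, hf.map_zero], ?_⟩
    · exact mul_left_cancel₀ hu0
        (hf.injOn (hmem z hz) (hmem y hy) (mul_left_cancel₀ (inv_ne_zero hu0) h))
    · rw [← taylorCoeff_one, hcoef, taylorCoeff_one, hf.deriv_zero]
      field_simp
  have hmaj : majorant F (ρ ^ 2) = majorant f (ρ ^ 2) := by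
    simp [majorant, hcoef, hu]
  have h2 := hFs.majorant_le_of_taylorCoeff_two_eq (c := ‖taylorCoeff f 2‖ / 2) (by positivity)
    (by rw [hcoef]; push_cast; rw [← hua]; field_simp) hρ0 hρ
  rwa [hmaj, mul_div_cancel₀ _ two_ne_zero] at h2

theorem majorant_sub_le_norm_sub {f : ℂ → ℂ} (hf : DifferentiableOn ℂ f (ball 0 1))
    (hinj : Set.InjOn f (ball 0 1)) {w : ℂ} (hw : w ∉ f '' ball 0 1) {ρ : ℝ} (hρ0 : 0 < ρ)
    (hρ : ρ ^ 2 + 2 * ρ = 1) : majorant (fun z => f z - f 0) (ρ ^ 2) ≤ ‖f 0 - w‖ := by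
  have h0mem : (0 : ℂ) ∈ ball (0 : ℂ) 1 := mem_ball_self one_pos
  have hd : deriv f 0 ≠ 0 := deriv_ne_zero_of_injOn
    (hf.analyticAt (isOpen_ball.mem_nhds h0mem)) (isOpen_ball.mem_nhds h0mem) hinj
  set F : ℂ → ℂ := fun z => (f z - f 0) / deriv f 0 with hF
  have hFd : DifferentiableOn ℂ F (ball 0 1) := (hf.sub_const _).div_const _
  have hFs : IsSchlicht F := by
    refine ⟨hFd, fun z hz y hy h => hinj hz hy ?_, by simp [hF], ?_⟩
    · simpa [hF, div_left_inj' hd] using h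
    · have := ((hf.differentiableAt (isOpen_ball.mem_nhds h0mem)).hasDerivAt.sub_const
        (f 0)).div_const (deriv f 0)
      rw [hF, this.deriv, div_self hd]
  have hW : (w - f 0) / deriv f 0 ∉ F '' ball 0 1 := by
    rintro ⟨z, hz, h⟩
    refine hw ⟨z, hz, ?_⟩
    simpa [hF, div_left_inj' hd] using h
  have h1 := hFs.one_le_norm_mul hW
  have h2 : majorant F (ρ ^ 2) ≤ ‖(w - f 0) / deriv f 0‖ :=
    (hFs.majorant_le hρ0 hρ).trans ((div_le_iff₀ (by positivity)).2 h1)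
  have h3 : (fun z => f z - f 0) = fun z => deriv f 0 * F z := by
    funext z
    simp only [hF]
    field_simp
  rw [h3]
  refine (majorant_mul_le (f := fun _ => deriv f 0) (by fun_prop) hFd (sq_nonneg ρ)
    (by linarith)).trans ?_
  rw [majorant_const]
  refine (mul_le_mul_of_nonneg_left h2 (norm_nonneg _)).trans_eq ?_
  rw [norm_div, mul_div_cancel₀ _ (norm_ne_zero_iff.2 hd), norm_sub_rev]

theorem isOpen_image_of_injOn {f : ℂ → ℂ} (hf : DifferentiableOn ℂ f (ball 0 1))
    (hinj : Set.InjOn f (ball 0 1)) {U : Set ℂ} (hU : U ⊆ ball 0 1) (hUo : IsOpen U) :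
    IsOpen (f '' U) := by
  rw [isOpen_iff_mem_nhds]
  rintro _ ⟨z, hz, rfl⟩
  have hn := isOpen_ball.mem_nhds (hU hz)
  have hfz := hf.analyticAt hn
  rw [← hfz.hasStrictDerivAt.map_nhds_eq (deriv_ne_zero_of_injOn hfz hn hinj)]
  exact image_mem_map (hUo.mem_nhds hz)

theorem image_ball_ne_univ {f : ℂ → ℂ} (hf : DifferentiableOn ℂ f (ball 0 1))
    (hinj : Set.InjOn f (ball 0 1)) : f '' ball 0 1 ≠ Set.univ := fun huniv => by
  set h := Function.invFunOn f (ball 0 1) with hh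
  have hex : ∀ y, ∃ z ∈ ball (0 : ℂ) 1, f z = y := fun y =>
    (huniv ▸ Set.mem_univ y : y ∈ f '' ball 0 1)
  have hmem : ∀ y, h y ∈ ball (0 : ℂ) 1 := fun y => Function.invFunOn_mem (hex y)
  have hfh : ∀ y, f (h y) = y := fun y => Function.invFunOn_eq (hex y)
  have hcont : Continuous h := by
    refine continuous_def.2 fun U hU => ?_
    convert! isOpen_image_of_injOn hf hinj Set.inter_subset_right (hU.inter isOpen_ball) using 1
    ext y
    refine ⟨fun hy => ⟨h y, ⟨hy, hmem y⟩, hfh y⟩, ?_⟩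
    rintro ⟨z, hz, rfl⟩
    have := hinj (hmem (f z)) hz.2 (hfh (f z))
    rw [Set.mem_preimage, this]
    exact hz.1
  have hdiff : Differentiable ℂ h := fun y => by
    have hn := isOpen_ball.mem_nhds (hmem y)
    exact (HasDerivAt.of_local_left_inverse hcont.continuousAt
      (hf.differentiableAt hn).hasDerivAt (deriv_ne_zero_of_injOn (hf.analyticAt hn) hn hinj)
      (Eventually.of_forall hfh)).differentiableAt
  have hb : Bornology.IsBounded (Set.range h) :=
    isBounded_ball.subset (Set.range_subset_iff.2 hmem)
  have h01 := hdiff.apply_eq_apply_of_bounded hb 0 1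
  have := (hfh 0).symm.trans ((congrArg f h01).trans (hfh 1))
  exact zero_ne_one this

theorem majorant_sub_le_infDist {f : ℂ → ℂ} (hf : DifferentiableOn ℂ f (ball 0 1))
    (hinj : Set.InjOn f (ball 0 1)) {ρ : ℝ} (hρ0 : 0 < ρ) (hρ : ρ ^ 2 + 2 * ρ = 1) :
    majorant (fun z => f z - f 0) (ρ ^ 2) ≤ infDist (f 0) (frontier (f '' ball 0 1)) := by
  have hopen := isOpen_image_of_injOn hf hinj subset_rfl isOpen_ball
  have hne : (frontier (f '' ball 0 1)).Nonempty := by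
    rw [nonempty_frontier_iff]
    exact ⟨(nonempty_ball.2 one_pos).image f, image_ball_ne_univ hf hinj⟩
  refine (le_infDist hne).2 fun w hw => ?_
  rw [dist_eq_norm]
  refine majorant_sub_le_norm_sub hf hinj (fun h => ?_) hρ0 hρ
  rw [hopen.frontier_eq] at hw
  exact hw.2 h

end BohrUnivalent


theorem bohr_subordination_univalent
    (f g : ℂ → ℂ) (b : ℕ → ℂ)
    (hf : DifferentiableOn ℂ f (Metric.ball (0 : ℂ) 1))
    (hinj : Set.InjOn f (Metric.ball (0 : ℂ) 1))
    (hg : ∀ z : ℂ, ‖z‖ < 1 → HasSum (fun n : ℕ => b n * z ^ n) (g z))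
    (hsub : ∃ w : ℂ → ℂ, DifferentiableOn ℂ w (Metric.ball (0 : ℂ) 1) ∧ w 0 = 0 ∧
      ∀ z : ℂ, ‖z‖ < 1 → ‖w z‖ < 1 ∧ g z = f (w z)) :
    ∀ r : ℝ, 0 ≤ r → r ≤ 3 - 2 * Real.sqrt 2 →
      ∑' n : ℕ, ‖b (n + 1)‖ * r ^ (n + 1) ≤
        Metric.infDist (f 0) (frontier (f '' Metric.ball (0 : ℂ) 1)) := by
  open BohrUnivalent in
  intro r hr0 hr
  obtain ⟨w, hw, hw0, hwg⟩ := hsub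
  rcases hr0.eq_or_lt with rfl | hr0
  · simpa using Metric.infDist_nonneg
  have hs : Real.sqrt 2 ^ 2 = 2 := Real.sq_sqrt zero_le_two
  have hs1 : 1.4 < Real.sqrt 2 := by rw [Real.lt_sqrt] <;> norm_num
  have hρ0 : 0 < Real.sqrt 2 - 1 := by linarith
  have hρ : (Real.sqrt 2 - 1) ^ 2 + 2 * (Real.sqrt 2 - 1) = 1 := by linear_combination hs
  have hr' : r ≤ (Real.sqrt 2 - 1) ^ 2 := hr.trans_eq (by linear_combination -hs)
  have hr1 : r ≤ 1 / 3 := by linarith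
  have hf0 : DifferentiableOn ℂ (fun z => f z - f 0) (Metric.ball 0 1) := hf.sub_const _
  have hcoef : ∀ n, taylorCoeff (fun z => f (w z) - f 0) n = b n - if n = 0 then f 0 else 0 :=
    congrFun <| taylorCoeff_eq_of_hasSum one_pos fun z hz => by
      have h1 := taylorCoeff_const (f 0) ▸ hasSum_taylorCoeff (f := fun _ => f 0) (by fun_prop) hz
      simpa only [sub_mul, (hwg z hz).2] using (hg z hz).sub h1
  have hsum : Summable fun n => ‖taylorCoeff (fun z => f (w z) - f 0) n‖ * r ^ n :=
    summable_majorant (hf0.fun_comp hw fun z hz => by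
      simpa using (hwg z (by simpa using hz)).1) hr0.le (by linarith)
  calc ∑' n : ℕ, ‖b (n + 1)‖ * r ^ (n + 1)
      = majorant (fun z => f (w z) - f 0) r := by
        rw [majorant, hsum.tsum_eq_zero_add, taylorCoeff_zero, hw0, sub_self]
        simp [hcoef]
    _ ≤ majorant (fun z => f z - f 0) ((Real.sqrt 2 - 1) ^ 2) :=
        majorant_comp_le hf0 hw (fun z hz => (hwg z hz).1) hr0 (by linarith) (by linarith)
          ((majorant_schwarz_le hw hw0 (fun z hz => (hwg z hz).1) hr0.le hr1).trans hr')
    _ ≤ _ := majorant_sub_le_infDist hf hinj hρ0 hρ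
end

section
/- Let f be analytic and univalent (injective) in the open unit disk 𝔻 with convex image f(𝔻), and let g(z) = Σ_{n=0}^∞ b_n z^n be analytic in 𝔻 and subordinate to f. Then Σ_{n=1}^∞ |b_n| r^n ≤ dist(f(0), ∂f(𝔻)) for all 0 ≤ r ≤ 1/3, where dist(f(0), ∂f(𝔻)) is the Euclidean distance from f(0) to the boundary of f(𝔻). -/
open Metric Set Filter Topology in
/-- An injective holomorphic function on the unit disk does not map onto the whole plane. -/
theorem Complex.image_ball_ne_univ_of_injOn {f : ℂ → ℂ}
    (hf : DifferentiableOn ℂ f (ball 0 1)) (hinj : InjOn f (ball 0 1))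
    (hopen : ∀ s ⊆ ball (0 : ℂ) 1, IsOpen s → IsOpen (f '' s)) :
    f '' ball 0 1 ≠ univ := by
  intro hU
  have hsurj : ∀ p, p ∈ f '' ball 0 1 := fun p => hU ▸ mem_univ p
  set F := Function.invFunOn f (ball 0 1) with hF
  have hmem : ∀ p, F p ∈ ball (0 : ℂ) 1 := fun p => Function.invFunOn_mem (hsurj p)
  have hfF : ∀ p, f (F p) = p := fun p => Function.invFunOn_eq (hsurj p)
  have hFinj : Function.Injective F := fun p q h => by rw [← hfF p, h, hfF]
  have hcont : Continuous F := by
    refine continuous_def.2 fun V hV => ?_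
    have : F ⁻¹' V = f '' (V ∩ ball 0 1) := by
      ext p
      refine ⟨fun hp => ⟨F p, ⟨hp, hmem p⟩, hfF p⟩, ?_⟩
      rintro ⟨z, ⟨hzV, hz⟩, rfl⟩
      have : F (f z) = z := hinj (hmem _) hz (hfF _)
      simpa [this] using hzV
    rw [this]
    exact hopen _ inter_subset_right (hV.inter isOpen_ball)
  have hfan : AnalyticOnNhd ℂ f (ball 0 1) := hf.analyticOnNhd isOpen_ball
  have hdiff : Differentiable ℂ F := by
    intro p
    refine (analyticAt_of_differentiable_on_punctured_nhds_of_continuousAt ?_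
      hcont.continuousAt).differentiableAt
    have hne : ∀ᶠ z in 𝓝[≠] (F p), deriv f z ≠ 0 := by
      refine (hfan.deriv _ (hmem p)).eventually_eq_zero_or_eventually_ne_zero.resolve_left ?_
      intro h0
      have hzero := hfan.deriv.eqOn_zero_of_preconnected_of_eventuallyEq_zero
        (convex_ball (0 : ℂ) 1).isPreconnected (hmem p) h0
      have h0m : (0 : ℂ) ∈ ball (0 : ℂ) 1 := by simp
      have h1m : (1 / 2 : ℂ) ∈ ball (0 : ℂ) 1 := by norm_num
      have := isOpen_ball.is_const_of_deriv_eq_zero (convex_ball (0 : ℂ) 1).isPreconnected hf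
        hzero h0m h1m
      have := hinj h0m h1m this
      norm_num at this
    have htend : Tendsto F (𝓝[≠] p) (𝓝[≠] (F p)) :=
      tendsto_nhdsWithin_iff.2 ⟨hcont.continuousAt.mono_left nhdsWithin_le_nhds,
        eventually_nhdsWithin_of_forall fun q hq h => hq (hFinj h)⟩
    filter_upwards [htend.eventually hne] with q hq
    exact (HasDerivAt.of_local_left_inverse hcont.continuousAt
      (hf.differentiableAt (isOpen_ball.mem_nhds (hmem q))).hasDerivAt hq
      (Eventually.of_forall hfF)).differentiableAt
  have hbdd : Bornology.IsBounded (range F) :=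
    isBounded_ball.subset (range_subset_iff.2 hmem)
  exact zero_ne_one (hFinj (hdiff.apply_eq_apply_of_bounded hbdd 0 1))

open Metric Real in
/-- Fourier coefficients of the real part of a holomorphic function on a circle. -/
theorem Complex.norm_circleAverage_mul_inv_pow_le {h : ℂ → ℂ} {R : ℝ} (hR : 0 < R)
    (hd : DifferentiableOn ℂ h (closedBall 0 R)) (hre : ∀ z ∈ sphere (0 : ℂ) R, 0 ≤ (h z).re)
    {n : ℕ} (hn : n ≠ 0) :
    ‖circleAverage (fun z => (z ^ n)⁻¹ * h z) 0 R‖ ≤ 2 * (h 0).re * (R ^ n)⁻¹ := by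
  have hhc : ContinuousOn h (sphere 0 R) := hd.continuousOn.mono sphere_subset_closedBall
  have hz0 : ∀ z ∈ sphere (0 : ℂ) R, z ≠ 0 := fun z hz => ne_of_mem_sphere hz hR.ne'
  have hinvc : ContinuousOn (fun z : ℂ => (z ^ n)⁻¹) (sphere 0 R) :=
    (continuous_pow n).continuousOn.inv₀ fun z hz => pow_ne_zero n (hz0 z hz)
  have hconjc : ContinuousOn (fun z : ℂ => (starRingEnd ℂ) (h z)) (sphere 0 R) :=
    Complex.continuous_conj.comp_continuousOn hhc
  have hdc : ∀ k : ℂ → ℂ, DifferentiableOn ℂ k (closedBall 0 R) →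
      circleAverage k 0 R = k 0 := fun k hk => by
    refine DiffContOnCl.circleAverage ?_
    rw [abs_of_pos hR]
    exact hk.diffContOnCl_ball subset_rfl
  have hci : ∀ {E : Type} [NormedAddCommGroup E] (k : ℂ → E), ContinuousOn k (sphere 0 R) →
      CircleIntegrable k 0 R := fun k hk => hk.circleIntegrable hR.le
  have hzero : circleAverage (fun z => (z ^ n)⁻¹ * (starRingEnd ℂ) (h z)) 0 R = 0 := by
    have h1 : circleAverage (fun z => z ^ n * h z) 0 R = 0 := by
      rw [hdc (fun z => z ^ n * h z) ((differentiable_pow n).differentiableOn.mul hd)]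
      simp [hn]
    have h2 := (Complex.conjCLE : ℂ →L[ℝ] ℂ).circleAverage_comp_comm
      (f := fun z => z ^ n * h z) (c := 0) (R := R)
      (hci _ ((continuous_pow n).continuousOn.mul hhc))
    rw [h1, map_zero] at h2
    have h3 : circleAverage (fun z => (z ^ n)⁻¹ * (starRingEnd ℂ) (h z)) 0 R =
        circleAverage (fun z => ((R ^ (2 * n))⁻¹ : ℝ) •
          ((Complex.conjCLE : ℂ →L[ℝ] ℂ) ∘ fun z => z ^ n * h z) z) 0 R := by
      refine circleAverage_congr_sphere fun z hz => ?_
      rw [abs_of_pos hR] at hz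
      have hzz : z * (starRingEnd ℂ) z = (R : ℂ) ^ 2 := by
        rw [Complex.mul_conj', mem_sphere_zero_iff_norm.1 hz]
      have hRC : (R : ℂ) ≠ 0 := by exact_mod_cast hR.ne'
      have hzn := hz0 z hz
      have key : (z ^ n)⁻¹ = ((R : ℂ) ^ (2 * n))⁻¹ * (starRingEnd ℂ) z ^ n := by
        rw [pow_mul, ← hzz, mul_pow]
        have : (starRingEnd ℂ) z ≠ 0 := by simpa using hzn
        field_simp
      simp [key, mul_assoc]
    rw [h3, circleAverage_fun_smul, h2, smul_zero]
  have hsum : circleAverage (fun z => (z ^ n)⁻¹ * h z) 0 R =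
      circleAverage (fun z => (z ^ n)⁻¹ * ((2 * (h z).re : ℝ) : ℂ)) 0 R := by
    have hadd := circleAverage_fun_add (hci (fun z => (z ^ n)⁻¹ * h z) (hinvc.mul hhc))
      (hci (fun z => (z ^ n)⁻¹ * (starRingEnd ℂ) (h z)) (hinvc.mul hconjc))
    rw [hzero, add_zero] at hadd
    rw [← hadd]
    congr 1
    ext1 z
    rw [← mul_add, Complex.add_conj]
  have hrec : ContinuousOn (fun z => (h z).re) (sphere 0 R) :=
    Complex.continuous_re.comp_continuousOn hhc
  have hmean : circleAverage (fun z => (h z).re) 0 R = (h 0).re := by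
    have := Complex.reCLM.circleAverage_comp_comm (hci h hhc)
    rw [hdc h hd] at this
    exact this
  calc ‖circleAverage (fun z => (z ^ n)⁻¹ * h z) 0 R‖
      ≤ circleAverage (fun z => ‖(z ^ n)⁻¹ * ((2 * (h z).re : ℝ) : ℂ)‖) 0 R := by
        rw [hsum, circleAverage_def, circleAverage_def, norm_smul, smul_eq_mul,
          Real.norm_of_nonneg (by positivity)]
        gcongr
        exact intervalIntegral.norm_integral_le_integral_norm (by positivity)
    _ = circleAverage (fun z => (2 * (R ^ n)⁻¹) • (h z).re) 0 R := by
        refine circleAverage_congr_sphere fun z hz => ?_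
        rw [abs_of_pos hR] at hz
        have := hre z hz
        simp only [norm_mul, norm_inv, norm_pow, mem_sphere_zero_iff_norm.1 hz,
          Complex.norm_real, Real.norm_of_nonneg this, Real.norm_ofNat, smul_eq_mul]
        ring
    _ = 2 * (h 0).re * (R ^ n)⁻¹ := by
        rw [circleAverage_fun_smul, hmean, smul_eq_mul]
        ring

open Metric Real Filter Topology in
/-- **Carathéodory's coefficient bound**: a power series with nonnegative real part on the unit
disk has coefficients bounded by twice the real part of its constant term. -/
theorem Complex.norm_coeff_le_of_re_nonneg {h : ℂ → ℂ} {c : ℕ → ℂ}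
    (hc : ∀ z : ℂ, ‖z‖ < 1 → HasSum (fun n => c n * z ^ n) (h z))
    (hre : ∀ z : ℂ, ‖z‖ < 1 → 0 ≤ (h z).re) {n : ℕ} (hn : n ≠ 0) :
    ‖c n‖ ≤ 2 * (c 0).re := by
  have hps : HasFPowerSeriesOnBall h (FormalMultilinearSeries.ofScalars ℂ c) 0 1 := by
    refine ⟨?_, one_pos, fun {y} hy => ?_⟩
    · refine ENNReal.le_of_forall_nnreal_lt fun r hr => ?_
      refine FormalMultilinearSeries.le_radius_of_tendsto _ (l := 0) ?_
      have hr1 : r < 1 := by exact_mod_cast hr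
      have := (hc (r : ℂ) (by simpa using hr1)).summable.tendsto_atTop_zero.norm
      simpa [FormalMultilinearSeries.ofScalars_norm] using this
    · have hy' : ‖y‖ < 1 := by
        simpa [← ofReal_norm] using hy
      simpa [FormalMultilinearSeries.ofScalars_apply_eq, mul_comm] using hc y hy'
  have hd : DifferentiableOn ℂ h (ball 0 1) := by
    have := hps.differentiableOn
    simpa [← Metric.eball_ofReal] using this
  have h0 : h 0 = c 0 := by
    refine (hc 0 (by simp)).unique ?_
    simpa using hasSum_single (f := fun n => c n * (0 : ℂ) ^ n) 0 (by simp +contextual)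
  have hbound : ∀ R : ℝ, 0 < R → R < 1 → ‖c n‖ ≤ 2 * (c 0).re * (R ^ n)⁻¹ := by
    intro R hR hR1
    have hdR : DifferentiableOn ℂ h (closedBall 0 R) := hd.mono (closedBall_subset_ball hR1)
    have hcauchy : cauchyPowerSeries h 0 R = FormalMultilinearSeries.ofScalars ℂ c := by
      lift R to NNReal using hR.le
      have hRps := hdR.hasFPowerSeriesOnBall (by exact_mod_cast hR)
      exact hRps.hasFPowerSeriesAt.eq_formalMultilinearSeries hps.hasFPowerSeriesAt
    have hcn : c n = circleAverage (fun z => (z ^ n)⁻¹ * h z) 0 R := by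
      have h1 := cauchyPowerSeries_apply h 0 R n 1
      rw [hcauchy, FormalMultilinearSeries.ofScalars_apply_eq] at h1
      rw [circleAverage_eq_circleIntegral hR.ne']
      simp only [one_pow, smul_eq_mul, mul_one] at h1
      rw [h1, smul_eq_mul]
      congr 2
      ext z
      simp only [sub_zero, one_div, inv_pow, smul_eq_mul]
      ring
    rw [hcn, ← h0]
    refine Complex.norm_circleAverage_mul_inv_pow_le hR hdR (fun z hz => hre z ?_) hn
    rwa [mem_sphere_zero_iff_norm.1 hz]
  have htend : Tendsto (fun R : ℝ => 2 * (c 0).re * (R ^ n)⁻¹) (𝓝[<] 1) (𝓝 (2 * (c 0).re)) := by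
    have : ContinuousAt (fun R : ℝ => 2 * (c 0).re * (R ^ n)⁻¹) 1 := by
      refine continuousAt_const.mul (ContinuousAt.inv₀ (by fun_prop) (by simp))
    have := this.tendsto.mono_left (nhdsWithin_le_nhds (s := Set.Iio 1))
    simpa using this
  refine ge_of_tendsto htend ?_
  filter_upwards [Ioo_mem_nhdsLT (zero_lt_one (α := ℝ))] with R hR
  exact hbound R hR.1 hR.2

/-- A power series with values in an open convex set has its nonconstant coefficients bounded by
twice the distance from its constant term to any point outside the set. -/
theorem Convex.norm_coeff_le_two_mul_dist {U : Set ℂ} (hU : Convex ℝ U) (hUo : IsOpen U)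
    {g : ℂ → ℂ} {b : ℕ → ℂ}
    (hg : ∀ z : ℂ, ‖z‖ < 1 → HasSum (fun n => b n * z ^ n) (g z))
    (hgU : ∀ z : ℂ, ‖z‖ < 1 → g z ∈ U) {a : ℂ} (ha : a ∉ U) {n : ℕ} (hn : n ≠ 0) :
    ‖b n‖ ≤ 2 * dist (b 0) a := by
  obtain ⟨φ, hφ⟩ := RCLike.geometric_hahn_banach_open_point (𝕜 := ℂ) hU hUo ha
  have hlin : ∀ z, φ z = φ 1 * z := fun z => by
    rw [mul_comm, ← smul_eq_mul, ← map_smul, smul_eq_mul, mul_one]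
  have hφ1 : 0 < ‖φ 1‖ := by
    refine norm_pos_iff.2 fun h => ?_
    have := hφ _ (hgU 0 (by simp))
    rw [hlin, hlin a, h] at this
    simp at this
  have hsum : ∀ z : ℂ, ‖z‖ < 1 →
      HasSum (fun n => ((if n = 0 then φ 1 * a else 0) - φ 1 * b n) * z ^ n)
        (φ 1 * a - φ 1 * g z) := fun z hz => by
    have h1 : HasSum (fun n => (if n = 0 then φ 1 * a else 0) * z ^ n) (φ 1 * a) := by
      convert! hasSum_single (f := fun n => (if n = 0 then φ 1 * a else 0) * z ^ n) 0
        (fun n hn => by simp [hn]) using 1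
      simp
    convert! h1.sub ((hg z hz).mul_left (φ 1)) using 2
    ring
  have hre : ∀ z : ℂ, ‖z‖ < 1 → 0 ≤ (φ 1 * a - φ 1 * g z).re := fun z hz => by
    have := hφ _ (hgU z hz)
    rw [hlin, hlin a] at this
    rw [Complex.sub_re]
    exact sub_nonneg.2 this.le
  have key := Complex.norm_coeff_le_of_re_nonneg hsum hre hn
  rw [if_neg hn, if_pos rfl, zero_sub, norm_neg, norm_mul, ← mul_sub] at key
  have h2 := (Complex.re_le_norm (φ 1 * (a - b 0)))
  rw [norm_mul, ← dist_eq_norm, dist_comm] at h2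
  refine le_of_mul_le_mul_left ?_ hφ1
  linarith


/-- Bohr phenomenon for subordination to a convex univalent function:
if `f` is analytic and injective on the unit disk with convex image and
`g = ∑ bₙ zⁿ` is subordinate to `f`, then
`∑_{n≥1} |bₙ| rⁿ ≤ dist(f 0, ∂ f(𝔻))` for `0 ≤ r ≤ 1/3`. -/
theorem bohr_subordination_convex
    (f g : ℂ → ℂ) (b : ℕ → ℂ)
    (hf : DifferentiableOn ℂ f (Metric.ball (0 : ℂ) 1))
    (hinj : Set.InjOn f (Metric.ball (0 : ℂ) 1))
    (hconv : Convex ℝ (f '' Metric.ball (0 : ℂ) 1))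
    (hg : ∀ z : ℂ, ‖z‖ < 1 → HasSum (fun n : ℕ => b n * z ^ n) (g z))
    (hsub : ∃ w : ℂ → ℂ, DifferentiableOn ℂ w (Metric.ball (0 : ℂ) 1) ∧ w 0 = 0 ∧
      ∀ z : ℂ, ‖z‖ < 1 → ‖w z‖ < 1 ∧ g z = f (w z)) :
    ∀ r : ℝ, 0 ≤ r → r ≤ 1 / 3 →
      ∑' n : ℕ, ‖b (n + 1)‖ * r ^ (n + 1) ≤
        Metric.infDist (f 0) (frontier (f '' Metric.ball (0 : ℂ) 1)) := by
  intro r hr0 hr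
  obtain ⟨w, -, hw0, hw⟩ := hsub
  have h0m : (0 : ℂ) ∈ Metric.ball (0 : ℂ) 1 := by simp
  have hopen : ∀ s ⊆ Metric.ball (0 : ℂ) 1, IsOpen s → IsOpen (f '' s) := by
    refine ((hf.analyticOnNhd Metric.isOpen_ball).is_constant_or_isOpen
      (convex_ball (0 : ℂ) 1).isPreconnected).resolve_left ?_
    rintro ⟨v, hv⟩
    have h1m : (1 / 2 : ℂ) ∈ Metric.ball (0 : ℂ) 1 := by norm_num
    have := hinj h0m h1m ((hv _ h0m).trans (hv _ h1m).symm)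
    norm_num at this
  have hUo : IsOpen (f '' Metric.ball (0 : ℂ) 1) := hopen _ subset_rfl Metric.isOpen_ball
  have hne : (frontier (f '' Metric.ball (0 : ℂ) 1)).Nonempty := by
    rw [Set.nonempty_iff_ne_empty]
    intro h
    rcases isClopen_iff.1 (isClopen_iff_frontier_eq_empty.2 h) with h | h
    · exact Set.notMem_empty _ (h ▸ Set.mem_image_of_mem f h0m)
    · exact Complex.image_ball_ne_univ_of_injOn hf hinj hopen h
  have hb0 : b 0 = f 0 := by
    have h1 := (hw 0 (by simp)).2
    rw [hw0] at h1
    rw [← h1]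
    refine HasSum.unique ?_ (hg 0 (by simp))
    simpa using hasSum_single (f := fun n => b n * (0 : ℂ) ^ n) 0 (by simp +contextual)
  refine (Metric.le_infDist hne).2 fun a ha => ?_
  have ha' : a ∉ f '' Metric.ball (0 : ℂ) 1 := by
    rw [hUo.frontier_eq] at ha
    exact ha.2
  have hterm : ∀ n, ‖b (n + 1)‖ * r ^ (n + 1) ≤ 2 * dist (f 0) a * (1 / 3) ^ (n + 1) := by
    intro n
    rw [← hb0]
    gcongr
    refine hconv.norm_coeff_le_two_mul_dist hUo hg (fun z hz => ?_) ha' n.succ_ne_zero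
    exact ⟨w z, by simpa using (hw z hz).1, (hw z hz).2.symm⟩
  have hgeo : HasSum (fun n : ℕ => 2 * dist (f 0) a * (1 / 3 : ℝ) ^ (n + 1)) (dist (f 0) a) := by
    convert! (hasSum_geometric_of_lt_one (r := (1 / 3 : ℝ)) (by norm_num)
      (by norm_num)).mul_left (2 * dist (f 0) a * (1 / 3)) using 1
    · ext n
      ring
    · ring
  have hsummable : Summable fun n : ℕ => ‖b (n + 1)‖ * r ^ (n + 1) :=
    Summable.of_nonneg_of_le (fun n => by positivity) hterm hgeo.summable
  exact hasSum_le hterm hsummable.hasSum hgeo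
end

section
/- Let f(z) = Σ_{k=1}^∞ a_{2k−1} z^{2k−1} be an odd analytic function in the open unit disk 𝔻 with |f(z)| ≤ 1 for all z ∈ 𝔻. Then Σ_{k=1}^∞ |a_{2k−1}| r^{2k−1} ≤ 1 for all 0 ≤ r ≤ r_*, where r_* is the unique root in the interval (1/√3, 1) of the equation 5r⁴ + 4r³ − 2r² − 4r + 1 = 0 (numerically r_* ≈ 0.7313). -/
open Filter Topology

open AddCircle in
/-- Parseval's inequality for an absolutely convergent Fourier series bounded by `1`. -/
lemma sum_norm_sq_le_one_of_fourier_bound (c : ℕ → ℂ) (m : ℕ → ℤ) (hm : Function.Injective m)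
    (hc : Summable fun k => ‖c k‖)
    (hb : ∀ (x : UnitAddCircle) (w : ℂ), HasSum (fun k => c k * fourier (m k) x) w → ‖w‖ ≤ 1)
    (s : Finset ℕ) : ∑ k ∈ s, ‖c k‖ ^ 2 ≤ 1 := by
  have hsum : Summable fun k => c k • (fourier (m k) : C(UnitAddCircle, ℂ)) := by
    refine .of_norm ?_
    simpa [norm_smul, fourier_norm] using hc
  obtain ⟨F, hF⟩ := hsum
  have hF1 : ‖F‖ ≤ 1 := by
    refine (ContinuousMap.norm_le _ zero_le_one).2 fun x => hb x _ ?_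
    simpa using (ContinuousMap.evalCLM ℂ x).hasSum hF
  set L := ContinuousMap.toLp (E := ℂ) 2 (haarAddCircle (T := (1 : ℝ))) ℂ with hL
  have hv : Orthonormal ℂ fun k => fourierLp (T := (1 : ℝ)) 2 (m k) := orthonormal_fourier.comp m hm
  have hLF : HasSum (fun k => c k • fourierLp (T := (1 : ℝ)) 2 (m k)) (L F) := by
    simpa [fourierLp, hL] using L.hasSum hF
  have hLF1 : ‖L F‖ ≤ 1 := by
    refine (L.le_opNorm F).trans (mul_le_one₀ ?_ (norm_nonneg _) hF1)
    refine (ContinuousMap.toLp_norm_le (μ := haarAddCircle (T := (1 : ℝ))) (𝕜 := ℂ)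
      (p := 2)).trans ?_
    simp [MeasureTheory.measureUnivNNReal]
  have hin (n : ℕ) : inner ℂ (fourierLp (T := (1 : ℝ)) 2 (m n)) (L F) = c n := by
    have h := (innerSL ℂ (fourierLp (T := (1 : ℝ)) 2 (m n))).hasSum hLF
    refine h.unique ?_
    have h2 := hasSum_ite_eq n (c n)
    refine h2.congr_fun ?_
    intro k
    have h3 := orthonormal_iff_ite.1 hv n k
    simp only [innerSL_apply_apply, inner_smul_right, h3, eq_comm (a := n)]
    split_ifs with hk <;> simp [hk]
  calc ∑ k ∈ s, ‖c k‖ ^ 2 = ∑ k ∈ s, ‖inner ℂ (fourierLp (T := (1 : ℝ)) 2 (m k)) (L F)‖ ^ 2 := by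
        simp only [hin]
    _ ≤ ‖L F‖ ^ 2 := hv.sum_inner_products_le _
    _ ≤ 1 := pow_le_one₀ (norm_nonneg _) hLF1

/-- The coefficients of an odd analytic function bounded by `1` in the disk have `ℓ²` norm at most
`1`. -/
lemma sum_norm_sq_le_one_of_odd_bound {f : ℂ → ℂ} {a : ℕ → ℂ}
    (hrep : ∀ z : ℂ, ‖z‖ < 1 → HasSum (fun k : ℕ => a k * z ^ (2 * k + 1)) (f z))
    (hbound : ∀ z : ℂ, ‖z‖ < 1 → ‖f z‖ ≤ 1) (s : Finset ℕ) :
    ∑ k ∈ s, ‖a k‖ ^ 2 ≤ 1 := by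
  have key : ∀ ρ ∈ Set.Ioo (0 : ℝ) 1, ∑ k ∈ s, (‖a k‖ * ρ ^ (2 * k + 1)) ^ 2 ≤ 1 := by
    intro ρ hρ
    have hn : ‖(ρ : ℂ)‖ = ρ := by simp [abs_of_pos hρ.1]
    have h := sum_norm_sq_le_one_of_fourier_bound (fun k => a k * (ρ : ℂ) ^ (2 * k + 1))
      (fun k => 2 * k + 1) (fun i j hij => by simpa using hij)
      (hrep ρ (by rw [hn]; exact hρ.2)).summable.norm ?_ s
    · simpa [hn, abs_of_pos hρ.1] using h
    intro x w hw
    set z : ℂ := ρ * fourier 1 x with hz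
    have hz1 : ‖z‖ < 1 := by
      simpa [hz, abs_of_pos hρ.1, Circle.norm_coe] using hρ.2
    have : w = f z := by
      refine hw.unique ((hrep z hz1).congr_fun ?_)
      intro k
      have h3 : fourier (2 * (k : ℤ) + 1) x = fourier 1 x ^ (2 * k + 1) := by
        rw [fourier_apply, fourier_apply, one_smul, ← Circle.coe_pow, ← AddCircle.toCircle_nsmul,
          ← natCast_zsmul]
        push_cast
        rfl
      rw [h3, hz, mul_pow, mul_assoc]
    exact this ▸ hbound z hz1
  have hcont : Continuous fun ρ : ℝ => ∑ k ∈ s, (‖a k‖ * ρ ^ (2 * k + 1)) ^ 2 := by fun_prop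
  have hlim := (hcont.tendsto 1).mono_left (nhdsWithin_le_nhds (s := Set.Iio 1))
  simp only [one_pow, mul_one] at hlim
  exact le_of_tendsto hlim (eventually_of_mem (Ioo_mem_nhdsLT zero_lt_one) key)

/-- Bohr-type inequality for odd bounded analytic functions: if
`f z = ∑_{k≥1} a_{2k-1} z^{2k-1}` is analytic in the unit disk with `|f| ≤ 1`,
then the majorant series is at most `1` for `0 ≤ r ≤ r⋆`, where `r⋆` is the
(unique) root in `(1/√3, 1)` of `5r⁴ + 4r³ - 2r² - 4r + 1 = 0`.
Here `a k` denotes the coefficient `a_{2k+1}` of `z^{2k+1}`. -/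
theorem bohr_odd_functions
    (f : ℂ → ℂ) (a : ℕ → ℂ)
    (hrep : ∀ z : ℂ, ‖z‖ < 1 → HasSum (fun k : ℕ => a k * z ^ (2 * k + 1)) (f z))
    (hbound : ∀ z : ℂ, ‖z‖ < 1 → ‖f z‖ ≤ 1) :
    ∀ rstar : ℝ, 1 / Real.sqrt 3 < rstar → rstar < 1 →
      5 * rstar ^ 4 + 4 * rstar ^ 3 - 2 * rstar ^ 2 - 4 * rstar + 1 = 0 →
      ∀ r : ℝ, 0 ≤ r → r ≤ rstar →
        ∑' k : ℕ, ‖a k‖ * r ^ (2 * k + 1) ≤ 1 := by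
  intro t ht0 ht1 hroot r hr0 hrt
  have ht : 0 < t := lt_trans (by positivity) ht0
  have ht34 : t < 3 / 4 := by
    by_contra! h
    nlinarith [mul_nonneg (sub_nonneg.2 h) (sub_nonneg.2 h), pow_pos ht 2, pow_pos ht 3,
      mul_nonneg (sub_nonneg.2 h) (pow_pos ht 2).le, mul_nonneg (sub_nonneg.2 h) (pow_pos ht 3).le]
  have hr : r ≤ 3 / 4 := hrt.trans ht34.le
  have hr2 : r ^ 2 ≤ 9 / 16 := by nlinarith
  have hr4 : r ^ 4 ≤ 81 / 256 := by nlinarith [sq_nonneg r]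
  refine Real.tsum_le_of_sum_le (fun k => by positivity) fun s => ?_
  have hgeo : ∑ k ∈ s, (r ^ (2 * k + 1)) ^ 2 ≤ 1 := by
    have hg : HasSum (fun k : ℕ => (r ^ (2 * k + 1)) ^ 2) (r ^ 2 * (1 - r ^ 4)⁻¹) := by
      refine ((hasSum_geometric_of_lt_one (by positivity)
        (show r ^ 4 < 1 by linarith)).mul_left (r ^ 2)).congr_fun ?_
      exact fun k => by ring
    refine (sum_le_hasSum s (fun k _ => by positivity) hg).trans ?_
    rw [← div_eq_mul_inv, div_le_one] <;> linarith
  have hcs := Finset.sum_mul_sq_le_sq_mul_sq s (fun k => ‖a k‖) (fun k => r ^ (2 * k + 1))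
  have h1 := sum_norm_sq_le_one_of_odd_bound hrep hbound s
  refine (sq_le_one_iff₀ (Finset.sum_nonneg fun k _ => by positivity)).1 (hcs.trans ?_)
  exact mul_le_one₀ h1 (Finset.sum_nonneg fun k _ => by positivity) hgeo
end

section
/- Let n ≥ 1 be an integer. If f(z) = Σ_{k=0}^∞ a_{nk} z^{nk} is analytic and bounded in the open unit disk 𝔻, then for every 0 ≤ r < 1, M_f(r) = Σ_{k=0}^∞ |a_{nk}| r^{nk} ≤ ‖f‖_∞ / √(1 − r^{2n}). -/
open Finset in
/-- Bessel's inequality for a trigonometric polynomial bounded on the unit circle. -/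
theorem sum_sq_norm_le_of_norm_sum_mul_pow_le (b : ℕ → ℂ) (N : ℕ) (B : ℝ)
    (h : ∀ z : ℂ, ‖z‖ = 1 → ‖∑ k ∈ range N, b k * z ^ k‖ ≤ B) :
    ∑ k ∈ range N, ‖b k‖ ^ 2 ≤ B ^ 2 := by
  set p : Polynomial ℂ := ∑ k ∈ range N, Polynomial.monomial k (b k) with hp
  have hcoeff (i : ℕ) : p.coeff i = if i < N then b i else 0 := by
    simp [hp, Polynomial.finsetSum_coeff, Polynomial.coeff_monomial]
  have hsub : p.support ⊆ range N := fun i hi => by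
    rw [Polynomial.mem_support_iff, hcoeff] at hi
    simpa using (ite_ne_right_iff.mp hi).1
  have hsum : ∑ k ∈ range N, ‖b k‖ ^ 2 = ∑ k ∈ p.support, ‖p.coeff k‖ ^ 2 := by
    rw [sum_subset hsub fun i _ hi => by simp [Polynomial.notMem_support_iff.mp hi]]
    refine sum_congr rfl fun i hi => ?_
    rw [hcoeff, if_pos (mem_range.mp hi)]
  rw [hsum, Polynomial.sum_sq_norm_coeff_eq_circleAverage]
  refine Real.circleAverage_mono_on_of_le_circle ?_ fun z hz => ?_
  · exact ContinuousOn.circleIntegrable zero_le_one (by fun_prop)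
  · have hz : ‖z‖ = 1 := by simpa using hz
    have := h z hz
    gcongr
    simpa [hp, Polynomial.eval_finsetSum] using this

open Filter Topology Finset in
/-- Bessel's inequality for an absolutely convergent Fourier series bounded on the unit circle. -/
theorem sum_sq_norm_le_of_norm_tsum_mul_pow_le (b : ℕ → ℂ) (C : ℝ)
    (hb : Summable fun k => ‖b k‖)
    (h : ∀ z : ℂ, ‖z‖ = 1 → ‖∑' k, b k * z ^ k‖ ≤ C) (M : ℕ) :
    ∑ k ∈ range M, ‖b k‖ ^ 2 ≤ C ^ 2 := by
  have hlim : Tendsto (fun N => (C + ∑' k, ‖b (k + N)‖) ^ 2) atTop (𝓝 (C ^ 2)) := by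
    simpa using ((tendsto_sum_nat_add fun k => ‖b k‖).const_add C).pow 2
  refine ge_of_tendsto hlim ?_
  filter_upwards [eventually_ge_atTop M] with N hN
  refine (sum_le_sum_of_subset_of_nonneg (range_mono hN) fun _ _ _ => by positivity).trans ?_
  refine sum_sq_norm_le_of_norm_sum_mul_pow_le b N _ fun z hz => ?_
  have hnorm (k : ℕ) : ‖b k * z ^ k‖ = ‖b k‖ := by simp [hz]
  have hs : Summable fun k => b k * z ^ k := .of_norm (by simpa only [hnorm] using hb)
  rw [eq_sub_of_add_eq (hs.sum_add_tsum_nat_add N)]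
  refine (norm_sub_le _ _).trans (add_le_add (h z hz) ?_)
  have htail : Summable fun k => ‖b (k + N) * z ^ (k + N)‖ := by
    simpa only [hnorm] using (summable_nat_add_iff N).mpr hb
  simpa only [hnorm] using norm_tsum_le_tsum_norm htail

open Filter Topology Finset in
/-- Taylor coefficients of an analytic function bounded by `C` on the unit disk have
square sum at most `C ^ 2`. -/
theorem sum_sq_norm_coeff_le_of_bounded (g : ℂ → ℂ) (a : ℕ → ℂ) (C : ℝ)
    (hrep : ∀ z : ℂ, ‖z‖ < 1 → HasSum (fun k : ℕ => a k * z ^ k) (g z))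
    (hbound : ∀ z : ℂ, ‖z‖ < 1 → ‖g z‖ ≤ C) (M : ℕ) :
    ∑ k ∈ range M, ‖a k‖ ^ 2 ≤ C ^ 2 := by
  have hlim : Tendsto (fun s : ℝ => ∑ k ∈ range M, ‖a k * (s : ℂ) ^ k‖ ^ 2) (𝓝[<] 1)
      (𝓝 (∑ k ∈ range M, ‖a k‖ ^ 2)) := by
    have hc : Continuous fun s : ℝ => ∑ k ∈ range M, ‖a k * (s : ℂ) ^ k‖ ^ 2 := by fun_prop
    simpa using (hc.tendsto 1).mono_left nhdsWithin_le_nhds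
  refine le_of_tendsto hlim ?_
  filter_upwards [Ioo_mem_nhdsLT (zero_lt_one' ℝ)] with s hs
  have hs1 : ‖(s : ℂ)‖ < 1 := by simpa [abs_of_pos hs.1] using hs.2
  refine sum_sq_norm_le_of_norm_tsum_mul_pow_le _ C (hrep s hs1).summable.norm (fun z hz => ?_) M
  have hsz : ‖(s : ℂ) * z‖ < 1 := by simpa [hz] using hs1
  simpa only [mul_pow, ← mul_assoc, ← (hrep _ hsz).tsum_eq] using hbound _ hsz

/-- A geometric majorant of a square-summable sequence, by Cauchy-Schwarz. -/
theorem tsum_mul_pow_le_div_sqrt (c : ℕ → ℝ) (C ρ : ℝ) (hc : ∀ k, 0 ≤ c k) (hC : 0 ≤ C)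
    (hρ0 : 0 ≤ ρ) (hρ1 : ρ < 1) (h : ∀ M, ∑ k ∈ Finset.range M, c k ^ 2 ≤ C ^ 2) :
    ∑' k, c k * ρ ^ k ≤ C / √(1 - ρ ^ 2) := by
  refine Real.tsum_le_of_sum_range_le (fun k => mul_nonneg (hc k) (by positivity)) fun M => ?_
  have hgeom : ∑ k ∈ Finset.range M, (ρ ^ k) ^ 2 ≤ (1 - ρ ^ 2)⁻¹ := by
    have hg := hasSum_geometric_of_lt_one (sq_nonneg ρ) (pow_lt_one₀ hρ0 hρ1 two_ne_zero)
    simp only [pow_right_comm ρ _ 2]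
    exact sum_le_hasSum _ (fun _ _ => by positivity) hg
  calc ∑ k ∈ Finset.range M, c k * ρ ^ k
      ≤ √(∑ k ∈ Finset.range M, c k ^ 2) * √(∑ k ∈ Finset.range M, (ρ ^ k) ^ 2) :=
        Real.sum_mul_le_sqrt_mul_sqrt _ _ _
    _ ≤ √(C ^ 2) * √((1 - ρ ^ 2)⁻¹) := by gcongr; exact h M
    _ = C / √(1 - ρ ^ 2) := by rw [Real.sqrt_sq hC, Real.sqrt_inv, div_eq_mul_inv]

/-- Landau-type estimate for `n`-symmetric bounded analytic functions:
if `f z = ∑_k a_{nk} z^{nk}` is analytic and bounded (by `C`) in the unit disk,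
then `∑_k |a_{nk}| r^{nk} ≤ C / √(1 - r^{2n})` for all `0 ≤ r < 1`. -/
theorem bohr_n_symmetric_landau_bound (n : ℕ) (hn : 1 ≤ n)
    (f : ℂ → ℂ) (a : ℕ → ℂ) (C : ℝ)
    (hrep : ∀ z : ℂ, ‖z‖ < 1 → HasSum (fun k : ℕ => a k * z ^ (n * k)) (f z))
    (hbound : ∀ z : ℂ, ‖z‖ < 1 → ‖f z‖ ≤ C) :
    ∀ r : ℝ, 0 ≤ r → r < 1 →
      ∑' k : ℕ, ‖a k‖ * r ^ (n * k) ≤ C / Real.sqrt (1 - r ^ (2 * n)) := by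
  intro r hr0 hr1
  have hn0 : n ≠ 0 := by omega
  have hroot (w : ℂ) (hw : ‖w‖ < 1) : ∃ z : ℂ, ‖z‖ < 1 ∧ z ^ n = w := by
    obtain ⟨z, rfl⟩ := IsAlgClosed.exists_pow_nat_eq w hn
    exact ⟨z, (pow_lt_one_iff_of_nonneg (norm_nonneg z) hn0).mp (by simpa using hw), rfl⟩
  have hC : 0 ≤ C := (norm_nonneg _).trans (hbound 0 (by simp))
  have hg (w : ℂ) (hw : ‖w‖ < 1) :
      HasSum (fun k => a k * w ^ k) (∑' k, a k * w ^ k) ∧ ‖∑' k, a k * w ^ k‖ ≤ C := by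
    obtain ⟨z, hz, rfl⟩ := hroot w hw
    simp only [← pow_mul]
    rw [(hrep z hz).tsum_eq]
    exact ⟨hrep z hz, hbound z hz⟩
  have hsq := sum_sq_norm_coeff_le_of_bounded _ a C (fun w hw => (hg w hw).1)
    fun w hw => (hg w hw).2
  have := tsum_mul_pow_le_div_sqrt (fun k => ‖a k‖) C (r ^ n) (fun k => norm_nonneg _) hC
    (by positivity) (pow_lt_one₀ hr0 hr1 hn0) hsq
  simpa only [← pow_mul, mul_comm n 2] using this
end
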